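/- arXiv:2110.15394 — 3 statements merged into one kernel-verified Lean document; each statement's English description precedes it below -/
import Mathlib

section
/- Let i, j with |i−j| > 1 and let x be a Kostant partition with f_i(x) ≠ 0 and f_j(x) ≠ 0. Then f_i(f_j(x)) = f_j(f_i(x)) ≠ 0, ε_i(f_j(x)) = ε_i(x), and ε_j(f_i(x)) = ε_j(x) (Stembridge axiom S2' for the modified operators in the orthogonal case). -/
open scoped BigOperators

namespace KFC

/-- A (candidate) root is a pair of 1-based indices. -/
abbrev Root : Type := ℕ × ℕ

/-- A Kostant partition is encoded as a multiplicity function on pairs. -/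
abbrev KPf : Type := Root → ℕ

/-- An entry of a signed word: a sign (`true` = '+', `false` = '−') together
with the root lying under it. -/
abbrev Entry : Type := Bool × Root

/-- `p` is a positive root of type `A_{n-1}`. -/
def IsPos (n : ℕ) (p : Root) : Prop := 1 ≤ p.1 ∧ p.1 < p.2 ∧ p.2 ≤ n

/-- `α` is a genuine Kostant partition for type `A_{n-1}`: it is supported on
positive roots. -/
def IsKP (n : ℕ) (α : KPf) : Prop := ∀ p, α p ≠ 0 → IsPos n p

/-- Add one copy of the root `r`. -/
def KPadd (α : KPf) (r : Root) : KPf := fun p => if p = r then α p + 1 else α p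

/-- Remove one copy of the root `r`. -/
def KPsub (α : KPf) (r : Root) : KPf := fun p => if p = r then α p - 1 else α p

/-- Replace one copy of `r` by one copy of `r'`. -/
def KPmove (α : KPf) (r r' : Root) : KPf := KPadd (KPsub α r) r'

/-- The signed word `W_i` of `α`: roots `(a,b)` ordered by decreasing `a` and,
for equal `a`, increasing `b`; a '+' under each `(h,i)` and a '−' under each
`(h,i+1)`. -/
def Wword (n i : ℕ) (α : KPf) : List Entry :=
  ((List.range (n+1)).reverse).flatMap (fun h =>
    List.replicate (α (h, i)) ((true, (h, i)) : Entry) ++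
    List.replicate (α (h, i+1)) ((false, (h, i+1)) : Entry))

/-- The signed word `W_i*` of `α`: roots `(a,b)` ordered by increasing `b` and,
for equal `b`, decreasing `a`; a '+' under each `(i+1,j)` and a '−' under each
`(i,j)`. -/
def Wstar (n i : ℕ) (α : KPf) : List Entry :=
  (List.range (n+1)).flatMap (fun j =>
    List.replicate (α (i+1, j)) ((true, (i+1, j)) : Entry) ++
    List.replicate (α (i, j)) ((false, (i, j)) : Entry))

/-- One step of the left-to-right reduction: a new '+' cancels the rightmost
surviving '−' (the surviving word always has the shape `+^a −^b`). -/
def redStep (s : List Entry) (e : Entry) : List Entry :=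
  match e.1, s.getLast? with
  | true, some (false, _) => s.dropLast
  | _, _ => s ++ [e]

/-- The reduced word (list of surviving entries, in order). -/
def reduceW (w : List Entry) : List Entry := w.foldl redStep []

def plusCt (w : List Entry) : ℕ := (w.filter (fun e => e.1)).length
def minusCt (w : List Entry) : ℕ := (w.filter (fun e => !e.1)).length

/-- `a_i`: number of '+' in the reduced word of `W_i`. -/
def aSt (n i : ℕ) (α : KPf) : ℕ := plusCt (reduceW (Wword n i α))
/-- `b_i`: number of '−' in the reduced word of `W_i`. -/
def bSt (n i : ℕ) (α : KPf) : ℕ := minusCt (reduceW (Wword n i α))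
/-- `a_i*`. -/
def aStar (n i : ℕ) (α : KPf) : ℕ := plusCt (reduceW (Wstar n i α))
/-- `b_i*`. -/
def bStar (n i : ℕ) (α : KPf) : ℕ := minusCt (reduceW (Wstar n i α))
/-- `u_i`: number of '+' in the reduced word of `W_i* W_i`. -/
def uSt (n i : ℕ) (α : KPf) : ℕ := plusCt (reduceW (Wstar n i α ++ Wword n i α))
/-- `v_i`: number of '−' in the reduced word of `W_i* W_i`. -/
def vSt (n i : ℕ) (α : KPf) : ℕ := minusCt (reduceW (Wstar n i α ++ Wword n i α))

/-- The root under the rightmost surviving '+'. -/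
def lastPlus (w : List Entry) : Option Root :=
  (((reduceW w).filter (fun e => e.1)).getLast?).map Prod.snd

/-- The root under the leftmost surviving '−'. -/
def headMinus (w : List Entry) : Option Root :=
  (((reduceW w).filter (fun e => !e.1)).head?).map Prod.snd

/-- The operator `f̃_i`. -/
def ftilde (n i : ℕ) (α : KPf) : Option KPf :=
  match lastPlus (Wword n i α) with
  | some r => some (KPmove α r (r.1, i+1))
  | none => some (KPadd α (i, i+1))

/-- The operator `ẽ_i`. -/
def etilde (n i : ℕ) (α : KPf) : Option KPf :=
  match headMinus (Wword n i α) with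
  | some r => if r = (i, i+1) then some (KPsub α (i, i+1)) else some (KPmove α r (r.1, i))
  | none => none

/-- The operator `f̃_i*`. -/
def ftildeS (n i : ℕ) (α : KPf) : Option KPf :=
  match lastPlus (Wstar n i α) with
  | some r => some (KPmove α r (i, r.2))
  | none => some (KPadd α (i, i+1))

/-- The operator `ẽ_i*`. -/
def etildeS (n i : ℕ) (α : KPf) : Option KPf :=
  match headMinus (Wstar n i α) with
  | some r => if r = (i, i+1) then some (KPsub α (i, i+1)) else some (KPmove α r (i+1, r.2))
  | none => none

/-- The modified operator `f_i`. -/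
def fop (n i : ℕ) (α : KPf) : Option KPf :=
  if bStar n i α < aSt n i α then ftilde n i α
  else if 0 < aStar n i α then ftildeS n i α
  else none

/-- The modified operator `e_i`. -/
def eop (n i : ℕ) (α : KPf) : Option KPf :=
  if bStar n i α ≤ aSt n i α then
    (if 0 < bSt n i α ∧ headMinus (Wword n i α) ≠ some (i, i+1) then etilde n i α else none)
  else
    (if headMinus (Wstar n i α) ≠ some (i, i+1) then etildeS n i α else none)

/-- The operator `ê_i`. -/
def ehat (n i : ℕ) (α : KPf) : Option KPf :=
  if bStar n i α ≤ aSt n i α then (if 0 < bSt n i α then etilde n i α else none)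
  else etildeS n i α

/-- Iterate a partially defined operator (`none` plays the role of `0`). -/
def iterO (g : KPf → Option KPf) : ℕ → KPf → Option KPf
  | 0, x => some x
  | k+1, x => (g x).bind (iterO g k)

/-- `ε_i(x) = max {k : e_i^k x ≠ 0}`. -/
noncomputable def epsS (n i : ℕ) (x : KPf) : ℕ := sSup {k | iterO (eop n i) k x ≠ none}
/-- `ε̂_i(x) = max {k : ê_i^k x ≠ 0}`. -/
noncomputable def epsHatS (n i : ℕ) (x : KPf) : ℕ := sSup {k | iterO (ehat n i) k x ≠ none}
/-- `φ_i(x) = max {k : f_i^k x ≠ 0}`. -/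
noncomputable def phiS (n i : ℕ) (x : KPf) : ℕ := sSup {k | iterO (fop n i) k x ≠ none}

noncomputable def epsO (n i : ℕ) (o : Option KPf) : ℕ := o.elim 0 (epsS n i)
noncomputable def epsHatO (n i : ℕ) (o : Option KPf) : ℕ := o.elim 0 (epsHatS n i)
noncomputable def phiO (n i : ℕ) (o : Option KPf) : ℕ := o.elim 0 (phiS n i)

/-- `e_l(γ) ≃ 0`. -/
def simZero (n l : ℕ) (γ : KPf) : Prop := eop n l γ ≠ ehat n l γ

/-- `e_l e_m (γ) ≃ 0`. -/
def simZero2 (n l m : ℕ) (γ : KPf) : Prop := ∃ δ, eop n m γ = some δ ∧ simZero n l δ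

/-- The box containing all relevant pairs. -/
def kbox (n : ℕ) : Finset (ℕ × ℕ) := Finset.range (n+1) ×ˢ Finset.range (n+1)

/-- `|α|`: number of parts of the Kostant partition. -/
def kpSize (n : ℕ) (α : KPf) : ℕ := ∑ p ∈ kbox n, α p

/-- The evaluation `ᾱ ∈ ℤ^n` (as a function on 1-based coordinates). -/
def kpEval (n : ℕ) (α : KPf) : ℕ → ℤ :=
  fun k => ∑ p ∈ kbox n, (α p : ℤ) * ((if p.1 = k then 1 else 0) - (if p.2 = k then 1 else 0))

/-- The simple root `α_i = ε_i − ε_{i+1}` as a vector. -/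
def srVec (i : ℕ) : ℕ → ℤ := fun k => (if k = i then 1 else 0) - (if k = i+1 then 1 else 0)

/-- `ρ = (n-1, n-2, …, 1, 0)` (on 1-based coordinates `1..n`). -/
def rhoVec (n : ℕ) : ℕ → ℤ := fun k => (n : ℤ) - k

/-- `⟨γ, α_i^∨⟩ = γ_i − γ_{i+1}`. -/
def pairCo (γ : ℕ → ℤ) (i : ℕ) : ℤ := γ i - γ (i+1)

/-- The permutation of 1-based coordinates induced by `w : Perm (Fin n)`. -/
def extP (n : ℕ) (w : Equiv.Perm (Fin n)) (k : ℕ) : ℕ :=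
  if h : 1 ≤ k ∧ k ≤ n then ((w ⟨k - 1, by omega⟩ : Fin n) : ℕ) + 1 else k

/-- `S_n` acting on `ℤ^n` by permuting coordinates: `(w·v)_k = v_{w⁻¹(k)}`. -/
def permAct (n : ℕ) (w : Equiv.Perm (Fin n)) (v : ℕ → ℤ) : ℕ → ℤ :=
  fun k => v (extP n w⁻¹ k)

/-- The simple transposition `s_i = (i, i+1)` (1-based). -/
def sT (n i : ℕ) : Equiv.Perm (Fin n) :=
  if h : 1 ≤ i ∧ i < n then Equiv.swap ⟨i - 1, by omega⟩ ⟨i, h.2⟩ else 1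

/-- Coxeter length = number of inversions. -/
def lenP (n : ℕ) (w : Equiv.Perm (Fin n)) : ℕ :=
  (Finset.univ.filter (fun p : Fin n × Fin n => p.1 < p.2 ∧ w p.2 < w p.1)).card

/-- The left weak Bruhat order: `u ≤ w` iff `ℓ(w) = ℓ(w u⁻¹) + ℓ(u)`. -/
def leftWeakLE (n : ℕ) (u w : Equiv.Perm (Fin n)) : Prop :=
  lenP n w = lenP n (w * u⁻¹) + lenP n u

/-- `λ + ρ` as a vector. -/
def lamRho (n : ℕ) (lam : ℕ → ℤ) : ℕ → ℤ := fun k => lam k + rhoVec n k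

/-- `(w, α) ∈ S_{λ,μ}`, i.e. `ᾱ = w(λ+ρ) − (μ+ρ)`. -/
def InS (n : ℕ) (lam mu : ℕ → ℤ) (w : Equiv.Perm (Fin n)) (α : KPf) : Prop :=
  IsKP n α ∧ ∀ k, 1 ≤ k → k ≤ n →
    kpEval n α k = permAct n w (lamRho n lam) k - (mu k + rhoVec n k)

/-- A directed edge `(w,α) →^i (s_i w, β)` of the `Φ`-graph. -/
def PhiEdge (n : ℕ) (lam mu : ℕ → ℤ) (v v' : Equiv.Perm (Fin n) × KPf) : Prop :=
  InS n lam mu v.1 v.2 ∧ InS n lam mu v'.1 v'.2 ∧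
  ∃ i, 1 ≤ i ∧ i ≤ n - 1 ∧
    pairCo (permAct n v.1 (lamRho n lam)) i < 0 ∧
    v'.1 = sT n i * v.1 ∧
    iterO (fop n i) (-(pairCo (permAct n v.1 (lamRho n lam)) i)).toNat v.2 = some v'.2

/-- Being in the same connected component of (the underlying undirected graph of)
the `Φ`-graph. -/
def Conn (n : ℕ) (lam mu : ℕ → ℤ) (v v' : Equiv.Perm (Fin n) × KPf) : Prop :=
  Relation.ReflTransGen (fun a b => PhiEdge n lam mu a b ∨ PhiEdge n lam mu b a) v v'

/-- `(w,β)` has a broken hexagon, broken by `Φ_i` after `Φ_j`. -/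
def BrokenHexAt (n : ℕ) (lam mu : ℕ → ℤ) (w : Equiv.Perm (Fin n)) (β : KPf) (i j : ℕ) : Prop :=
  (j = i + 1 ∨ i = j + 1) ∧ 1 ≤ i ∧ i ≤ n - 1 ∧ 1 ≤ j ∧ j ≤ n - 1 ∧
  0 < pairCo (permAct n w (lamRho n lam)) i ∧
  0 < pairCo (permAct n w (lamRho n lam)) j ∧
  iterO (eop n i) (pairCo (permAct n w (lamRho n lam)) i).toNat β ≠ none ∧
  ∃ δ, iterO (eop n j) (pairCo (permAct n w (lamRho n lam)) j).toNat β = some δ ∧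
    epsS n i δ < (pairCo (permAct n w (lamRho n lam)) i).toNat +
      (pairCo (permAct n w (lamRho n lam)) j).toNat

/-- `γ` is obtained from `β` by an initial segment of the operator sequence
(`e_i` applied `ki` times, then `e_j` applied `ki+kj` times, then `e_i` applied
`kj` times). -/
def alongPath (n i j ki kj : ℕ) (β γ : KPf) : Prop :=
  (∃ a ≤ ki, iterO (eop n i) a β = some γ) ∨
  (∃ b ≤ ki + kj, (iterO (eop n i) ki β).bind (iterO (eop n j) b) = some γ) ∨
  (∃ c ≤ kj, ((iterO (eop n i) ki β).bind (iterO (eop n j) (ki + kj))).bind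
      (iterO (eop n i) c) = some γ)

/-- Conjecture A: no broken diamonds along the hexagon paths. -/
def ConjA (n : ℕ) (lam mu : ℕ → ℤ) : Prop :=
  ∀ (w : Equiv.Perm (Fin n)) (β : KPf) (i j : ℕ),
    InS n lam mu w β → 1 ≤ i → i ≤ n - 1 → 1 ≤ j → j ≤ n - 1 → (j = i + 1 ∨ i = j + 1) →
    ∀ ki kj : ℤ,
      ki = pairCo (permAct n w (lamRho n lam)) i →
      kj = pairCo (permAct n w (lamRho n lam)) j →
      0 < ki → 0 < kj →
      iterO (eop n i) ki.toNat β ≠ none → iterO (eop n j) kj.toNat β ≠ none →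
      ∀ γ : KPf,
        (alongPath n i j ki.toNat kj.toNat β γ ∨ alongPath n j i kj.toNat ki.toNat β γ) →
        ¬ (simZero2 n i j γ ∧ simZero2 n j i γ)

/-- Conjecture B: broken hexagons propagate up to the source vertex. -/
def ConjB (n : ℕ) (lam mu : ℕ → ℤ) : Prop :=
  ∀ (w : Equiv.Perm (Fin n)) (β α : KPf) (i j : ℕ),
    InS n lam mu w β → InS n lam mu 1 α → Conn n lam mu (1, α) (w, β) →
    BrokenHexAt n lam mu w β i j → ∃ j', BrokenHexAt n lam mu 1 α i j'

/-- The Kostka–Foulkes polynomial `K_{λ,μ}(t) = Σ_{(w,α) ∈ S_{λ,μ}} sgn(w) t^{|α|}`. -/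
noncomputable def KF (n : ℕ) (lam mu : ℕ → ℤ) : Polynomial ℤ :=
  ∑ᶠ (w : Equiv.Perm (Fin n)) (α : KPf) (_ : InS n lam mu w α),
    ((Equiv.Perm.sign w : ℤ) • (Polynomial.X ^ kpSize n α) : Polynomial ℤ)

end KFC


namespace KFC

/-! ### Words made of blocks, and their reduction -/

/-- The signed word with blocks indexed by `k < N`, the `k`-th block consisting of the copies of
`u k`, signed `+`, followed by the copies of `v k`, signed `-`. -/
def blockWord (u v : ℕ → Root) (N : ℕ) (x : KPf) : List Entry :=
  (List.range N).flatMap (fun k =>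
    List.replicate (x (u k)) ((true, u k) : Entry) ++
    List.replicate (x (v k)) ((false, v k) : Entry))

/-- The excess of `+` over `-` in the first `k` blocks. -/
def excess (u v : ℕ → Root) (x : KPf) (k : ℕ) : ℤ :=
  ∑ l ∈ Finset.range k, ((x (u l) : ℤ) - x (v l))

/-- The excess of `+` over `-` up to the end of the `+` part of the block `k`. -/
def height (u v : ℕ → Root) (x : KPf) (k : ℕ) : ℤ := excess u v x k + x (u k)

lemma excess_zero (u v : ℕ → Root) (x : KPf) : excess u v x 0 = 0 := by simp [excess]

lemma excess_succ (u v : ℕ → Root) (x : KPf) (k : ℕ) :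
    excess u v x (k + 1) = excess u v x k + (x (u k) - x (v k)) :=
  Finset.sum_range_succ _ _

lemma height_succ (u v : ℕ → Root) (x : KPf) (k : ℕ) :
    height u v x (k + 1) = height u v x k - x (v k) + x (u (k + 1)) := by
  simp only [height, excess_succ]; ring

/-- The reduced word `(+)^a (-)^b` with prescribed lists of underlying roots. -/
def plusMinus (P Q : List Root) : List Entry :=
  P.map (fun r => (true, r)) ++ Q.map (fun r => (false, r))

lemma foldl_redStep_minus (P Q : List Root) (r : Root) (m : ℕ) :
    (List.replicate m ((false, r) : Entry)).foldl redStep (plusMinus P Q) =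
      plusMinus P (Q ++ List.replicate m r) := by
  induction m generalizing Q with
  | zero => simp
  | succ m ih =>
    have h : redStep (plusMinus P Q) (false, r) = plusMinus P (Q ++ [r]) := by
      simp [redStep, plusMinus]
    rw [List.replicate_succ, List.foldl_cons, h, ih]
    simp [List.replicate_succ]

lemma redStep_plus_nil (P : List Root) (r : Root) :
    redStep (plusMinus P []) (true, r) = plusMinus (P ++ [r]) [] := by
  rcases List.eq_nil_or_concat P with rfl | ⟨P, p, rfl⟩ <;> simp [redStep, plusMinus]

lemma redStep_plus_concat (P Q : List Root) (q r : Root) :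
    redStep (plusMinus P (Q ++ [q])) (true, r) = plusMinus P Q := by
  have h : plusMinus P (Q ++ [q]) = plusMinus P Q ++ [(false, q)] := by simp [plusMinus]
  simp [redStep, h]

lemma foldl_redStep_plus (P Q : List Root) (r : Root) (m : ℕ) :
    (List.replicate m ((true, r) : Entry)).foldl redStep (plusMinus P Q) =
      plusMinus (P ++ List.replicate (m - Q.length) r) (Q.take (Q.length - m)) := by
  induction m generalizing P Q with
  | zero => simp
  | succ m ih =>
    rw [List.replicate_succ, List.foldl_cons]
    rcases List.eq_nil_or_concat Q with rfl | ⟨Q, q, rfl⟩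
    · rw [redStep_plus_nil, ih]
      simp [List.replicate_succ]
    · rw [List.concat_eq_append, redStep_plus_concat, ih]
      simp only [List.length_append, List.length_cons, List.length_nil, Nat.zero_add,
        Nat.add_sub_add_right]
      rw [List.take_append_of_le_length (by omega)]

lemma exists_reduceW_blockWord (u v : ℕ → Root) (N : ℕ) (x : KPf) :
    ∃ P Q : List Root, reduceW (blockWord u v N x) = plusMinus P Q ∧
      (∀ k < N, height u v x k ≤ P.length) ∧
      (Q.length : ℤ) = P.length - excess u v x N ∧
      (P ≠ [] → ∃ k < N, height u v x k = P.length ∧ (∀ l < k, height u v x l < P.length) ∧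
        P.getLast? = some (u k)) ∧
      (Q ≠ [] → ∃ k < N, height u v x k = P.length ∧
        (∀ l < N, k < l → height u v x l < P.length) ∧ Q.head? = some (v k)) := by
  induction N with
  | zero => exact ⟨[], [], by simp [blockWord, reduceW, plusMinus, excess]⟩
  | succ N ih =>
    obtain ⟨P, Q, hred, hle, hlen, hP, hQ⟩ := ih
    have hred' : reduceW (blockWord u v (N + 1) x) =
        plusMinus (P ++ List.replicate (x (u N) - Q.length) (u N))
          (Q.take (Q.length - x (u N)) ++ List.replicate (x (v N)) (v N)) := by
      have h : blockWord u v (N + 1) x = blockWord u v N x ++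
          (List.replicate (x (u N)) (true, u N) ++ List.replicate (x (v N)) (false, v N)) := by
        simp [blockWord, List.range_succ]
      rw [reduceW, h, List.foldl_append, List.foldl_append]
      change List.foldl redStep (List.foldl redStep (reduceW (blockWord u v N x)) _) _ = _
      rw [hred, foldl_redStep_plus, foldl_redStep_minus]
    have hN : height u v x N = P.length - Q.length + x (u N) := by
      simp only [height]; omega
    have hex := excess_succ u v x N
    refine ⟨_, _, hred', ?_, ?_, ?_, ?_⟩
    · intro k hk
      simp only [List.length_append, List.length_replicate]
      rcases Nat.lt_succ_iff_lt_or_eq.1 hk with hk | rfl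
      · have := hle k hk
        omega
      · omega
    · simp only [List.length_append, List.length_replicate, List.length_take]
      omega
    · intro hne
      rcases Nat.lt_or_ge Q.length (x (u N)) with hlt | hge
      · refine ⟨N, by omega, ?_, ?_, ?_⟩
        · simp only [List.length_append, List.length_replicate]
          omega
        · intro l hl
          have := hle l hl
          simp only [List.length_append, List.length_replicate]
          omega
        · obtain ⟨m, hm⟩ : ∃ m, x (u N) - Q.length = m + 1 := ⟨x (u N) - Q.length - 1, by omega⟩
          simp [hm, List.replicate_succ']
      · have h0 : x (u N) - Q.length = 0 := by omega
        simp only [h0, List.replicate_zero, List.append_nil] at hne ⊢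
        obtain ⟨k, hk, h⟩ := hP hne
        exact ⟨k, by omega, h⟩
    · intro hne
      rcases Nat.lt_or_ge (x (u N)) Q.length with hlt | hge
      · obtain ⟨k, hk, hk1, hk2, hk3⟩ := hQ (by rintro rfl; simp at hlt)
        have h0 : x (u N) - Q.length = 0 := by omega
        simp only [h0, List.replicate_zero, List.append_nil]
        refine ⟨k, by omega, hk1, ?_, ?_⟩
        · intro l hl hkl
          rcases Nat.lt_succ_iff_lt_or_eq.1 hl with hl | rfl
          · exact hk2 l hl hkl
          · omega
        · rw [List.head?_append, List.head?_take, if_neg (by omega), hk3]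
          rfl
      · have h0 : Q.length - x (u N) = 0 := by omega
        simp only [h0, List.take_zero, List.nil_append] at hne ⊢
        refine ⟨N, by omega, ?_, fun l hl hl' => by omega, ?_⟩
        · simp only [List.length_append, List.length_replicate]
          omega
        · obtain ⟨m, hm⟩ : ∃ m, x (v N) = m + 1 :=
            Nat.exists_eq_succ_of_ne_zero (by rintro h; simp [h] at hne)
          simp [hm, List.replicate_succ]

lemma plusCt_plusMinus (P Q : List Root) : plusCt (plusMinus P Q) = P.length := by
  simp [plusCt, plusMinus, List.filter_map, Function.comp_def]

lemma minusCt_plusMinus (P Q : List Root) : minusCt (plusMinus P Q) = Q.length := by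
  simp [minusCt, plusMinus, List.filter_map, Function.comp_def]

/-- `m` is the largest height of a block. -/
def IsMaxHeight (u v : ℕ → Root) (N : ℕ) (x : KPf) (m : ℤ) : Prop :=
  (∃ k < N, height u v x k = m) ∧ ∀ k < N, height u v x k ≤ m

/-- The rightmost surviving `+` lies in the block `k`. -/
def FPos (u v : ℕ → Root) (N : ℕ) (x : KPf) (k : ℕ) : Prop :=
  k < N ∧ (∀ l < k, height u v x l < height u v x k) ∧
    (∀ l < N, height u v x l ≤ height u v x k) ∧ 0 < height u v x k

/-- The leftmost surviving `-` lies in the block `k`. -/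
def EPos (u v : ℕ → Root) (N : ℕ) (x : KPf) (k : ℕ) : Prop :=
  k < N ∧ (∀ l < N, k < l → height u v x l < height u v x k) ∧
    (∀ l < N, height u v x l ≤ height u v x k) ∧ excess u v x N < height u v x k

section Positions

variable {u v : ℕ → Root} {N : ℕ} {x : KPf} {k l : ℕ} {m : ℤ}

lemma IsMaxHeight.unique {m' : ℤ} (h : IsMaxHeight u v N x m) (h' : IsMaxHeight u v N x m') :
    m = m' := by
  obtain ⟨⟨k, hk, rfl⟩, h2⟩ := h
  obtain ⟨⟨k', hk', rfl⟩, h2'⟩ := h'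
  exact le_antisymm (h2' k hk) (h2 k' hk')

lemma FPos.isMaxHeight (h : FPos u v N x k) : IsMaxHeight u v N x (height u v x k) :=
  ⟨⟨k, h.1, rfl⟩, h.2.2.1⟩

lemma EPos.isMaxHeight (h : EPos u v N x k) : IsMaxHeight u v N x (height u v x k) :=
  ⟨⟨k, h.1, rfl⟩, h.2.2.1⟩

lemma FPos.unique (h : FPos u v N x k) (h' : FPos u v N x l) : k = l := by
  obtain ⟨h1, h2, h3, -⟩ := h
  obtain ⟨h1', h2', h3', -⟩ := h'
  rcases lt_trichotomy k l with hkl | hkl | hkl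
  · exact absurd (h2' k hkl) (not_lt.2 (h3 l h1'))
  · exact hkl
  · exact absurd (h2 l hkl) (not_lt.2 (h3' k h1))

lemma EPos.unique (h : EPos u v N x k) (h' : EPos u v N x l) : k = l := by
  obtain ⟨h1, h2, h3, -⟩ := h
  obtain ⟨h1', h2', h3', -⟩ := h'
  rcases lt_trichotomy k l with hkl | hkl | hkl
  · exact absurd (h2 l h1' hkl) (not_lt.2 (h3' k h1))
  · exact hkl
  · exact absurd (h2' k h1 hkl) (not_lt.2 (h3 l h1'))

lemma IsMaxHeight.exists_fPos (h : IsMaxHeight u v N x m) (hm : 0 < m) :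
    ∃ k, FPos u v N x k := by
  classical
  obtain ⟨hex, hle⟩ := h
  obtain ⟨hk, hkm⟩ := Nat.find_spec hex
  refine ⟨_, hk, fun l hl => ?_, fun l hl => (hle l hl).trans_eq hkm.symm, hm.trans_eq hkm.symm⟩
  have h1 := Nat.find_min hex hl
  exact (lt_of_le_of_ne (hle l (hl.trans hk)) fun h2 => h1 ⟨hl.trans hk, h2⟩).trans_eq hkm.symm

lemma IsMaxHeight.exists_ePos (h : IsMaxHeight u v N x m) (hm : excess u v x N < m) :
    ∃ k, EPos u v N x k := by
  classical
  obtain ⟨⟨k₀, hk₀, hk₀m⟩, hle⟩ := h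
  set k := Nat.findGreatest (fun k => k < N ∧ height u v x k = m) N with hkdef
  obtain ⟨hk, hkm⟩ : k < N ∧ height u v x k = m :=
    Nat.findGreatest_spec (P := fun k => k < N ∧ height u v x k = m) hk₀.le ⟨hk₀, hk₀m⟩
  refine ⟨k, hk, fun l hl hkl => ?_, fun l hl => hkm ▸ hle l hl, hkm ▸ hm⟩
  have h1 := Nat.findGreatest_is_greatest hkl hl.le
  exact hkm ▸ lt_of_le_of_ne (hle l hl) fun h2 => h1 ⟨hl, h2⟩

lemma FPos.pos (h : FPos u v N x k) : 0 < x (u k) := by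
  obtain ⟨hk, h1, -, h2⟩ := h
  cases k with
  | zero => simp only [height, excess_zero] at h2; omega
  | succ k =>
    have := h1 k (by omega)
    rw [height_succ] at this
    omega

lemma EPos.pos (h : EPos u v N x k) : 0 < x (v k) := by
  obtain ⟨hk, h1, -, h2⟩ := h
  rcases Nat.lt_or_ge (k + 1) N with hlt | hge
  · have := h1 (k + 1) hlt (by omega)
    rw [height_succ] at this
    omega
  · obtain rfl : N = k + 1 := by omega
    rw [excess_succ, height] at h2
    omega

lemma isMaxHeight_plusCt (hN : 0 < N) :
    IsMaxHeight u v N x (plusCt (reduceW (blockWord u v N x))) := by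
  obtain ⟨P, Q, hred, hle, -, hP, -⟩ := exists_reduceW_blockWord u v N x
  rw [hred, plusCt_plusMinus]
  refine ⟨?_, hle⟩
  by_cases hne : P = []
  · refine ⟨0, hN, le_antisymm (hle 0 hN) ?_⟩
    simp [hne, height, excess_zero]
  · obtain ⟨k, hk, h, -⟩ := hP hne
    exact ⟨k, hk, h⟩

lemma minusCt_eq :
    (minusCt (reduceW (blockWord u v N x)) : ℤ) =
      plusCt (reduceW (blockWord u v N x)) - excess u v x N := by
  obtain ⟨P, Q, hred, -, h, -⟩ := exists_reduceW_blockWord u v N x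
  rw [hred, plusCt_plusMinus, minusCt_plusMinus, h]

lemma lastPlus_eq_some {r : Root} :
    lastPlus (blockWord u v N x) = some r ↔ ∃ k, FPos u v N x k ∧ u k = r := by
  obtain ⟨P, Q, hred, hle, -, hP, -⟩ := exists_reduceW_blockWord u v N x
  have hlast : lastPlus (blockWord u v N x) = P.getLast? := by
    simp [lastPlus, hred, plusMinus, List.filter_map, Function.comp_def]
  have key : P ≠ [] → ∃ k, FPos u v N x k ∧ P.getLast? = some (u k) := fun hne => by
    obtain ⟨k, hk, h1, h2, h3⟩ := hP hne
    have := List.length_pos_iff.2 hne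
    exact ⟨k, ⟨hk, h1 ▸ h2, h1 ▸ hle, by omega⟩, h3⟩
  rw [hlast]
  constructor
  · intro h
    obtain ⟨k, hk, hk'⟩ := key (by rintro rfl; simp at h)
    exact ⟨k, hk, by simpa [hk'] using h⟩
  · rintro ⟨k, hk, rfl⟩
    obtain ⟨l, hl, hl'⟩ := key (by
      rintro rfl
      have h1 := hle k hk.1
      have h2 := hk.2.2.2
      simp at h1
      omega)
    rw [hl', hl.unique hk]

lemma headMinus_eq_some {r : Root} :
    headMinus (blockWord u v N x) = some r ↔ ∃ k, EPos u v N x k ∧ v k = r := by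
  obtain ⟨P, Q, hred, hle, hlen, -, hQ⟩ := exists_reduceW_blockWord u v N x
  have hhead : headMinus (blockWord u v N x) = Q.head? := by
    simp [headMinus, hred, plusMinus, List.filter_map, Function.comp_def]
  have key : Q ≠ [] → ∃ k, EPos u v N x k ∧ Q.head? = some (v k) := fun hne => by
    obtain ⟨k, hk, h1, h2, h3⟩ := hQ hne
    have := List.length_pos_iff.2 hne
    exact ⟨k, ⟨hk, h1 ▸ h2, h1 ▸ hle, by omega⟩, h3⟩
  rw [hhead]
  constructor
  · intro h
    obtain ⟨k, hk, hk'⟩ := key (by rintro rfl; simp at h)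
    exact ⟨k, hk, by simpa [hk'] using h⟩
  · rintro ⟨k, hk, rfl⟩
    obtain ⟨l, hl, hl'⟩ := key (by
      rintro rfl
      have h1 := hle k hk.1
      have h2 := hk.2.2.2
      simp at hlen
      omega)
    rw [hl', hl.unique hk]

lemma plusCt_pos_iff :
    0 < plusCt (reduceW (blockWord u v N x)) ↔ lastPlus (blockWord u v N x) ≠ none := by
  obtain ⟨P, Q, hred, -⟩ := exists_reduceW_blockWord u v N x
  rw [hred, plusCt_plusMinus]
  simp [lastPlus, hred, plusMinus, List.filter_map, Function.comp_def, List.length_pos_iff]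

lemma minusCt_pos_iff :
    0 < minusCt (reduceW (blockWord u v N x)) ↔ headMinus (blockWord u v N x) ≠ none := by
  obtain ⟨P, Q, hred, -⟩ := exists_reduceW_blockWord u v N x
  rw [hred, minusCt_plusMinus]
  simp [headMinus, hred, plusMinus, List.filter_map, Function.comp_def, List.length_pos_iff]

end Positions

/-! ### Moving one root -/

lemma KPmove_cast {x : KPf} {r : Root} (s : Root) (h : 0 < x r) (t : Root) :
    (KPmove x r s t : ℤ) = x t - (if t = r then 1 else 0) + (if t = s then 1 else 0) := by
  unfold KPmove KPadd KPsub
  by_cases h1 : t = r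
  · subst h1
    by_cases h2 : t = s
    · subst h2
      simp only [if_true]
      omega
    · simp only [h2, if_true, if_false]
      omega
  · by_cases h2 : t = s
    · subst h2
      simp [h1]
    · simp [h1, h2]

/-- `y` is obtained from `x` by moving a root of the block `k` from its `+` to its `-` part if
`σ = 1`, and from its `-` to its `+` part if `σ = -1`. -/
def Shift (u v : ℕ → Root) (σ : ℤ) (k : ℕ) (x y : KPf) : Prop :=
  ∀ r, (y r : ℤ) = x r + σ * ((if r = v k then 1 else 0) - (if r = u k then 1 else 0))

section Shift

variable {u v u' v' : ℕ → Root} {N : ℕ} {x y z w w' : KPf} {k k' l l' : ℕ}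

lemma FPos.shift (h : FPos u v N x k) : Shift u v 1 k x (KPmove x (u k) (v k)) := fun r => by
  rw [KPmove_cast _ h.pos]; ring

lemma EPos.shift (h : EPos u v N x k) : Shift u v (-1) k x (KPmove x (v k) (u k)) := fun r => by
  rw [KPmove_cast _ h.pos]; ring

lemma Shift.congr {σ : ℤ} (hxy : Shift u v σ k x y) {r : ℕ → Root} {m : ℕ}
    (h1 : r m ≠ u k) (h2 : r m ≠ v k) : y (r m) = x (r m) := by
  have := hxy (r m)
  simp only [h1, h2, if_false] at this
  omega

/-- Two families of blocks meeting in exactly four roots, which lie in two consecutive blocks of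
each family. -/
structure Crossing (N : ℕ) (u v u' v' : ℕ → Root) (q p : ℕ) : Prop where
  hq : q + 1 < N
  hp : p + 1 < N
  uu : ∀ k < N, ∀ l < N, (u k = u' l ↔ k = q ∧ l = p)
  uv : ∀ k < N, ∀ l < N, (u k = v' l ↔ k = q + 1 ∧ l = p)
  vu : ∀ k < N, ∀ l < N, (v k = u' l ↔ k = q ∧ l = p + 1)
  vv : ∀ k < N, ∀ l < N, (v k = v' l ↔ k = q + 1 ∧ l = p + 1)

variable {q p : ℕ}

lemma Crossing.symm (h : Crossing N u v u' v' q p) : Crossing N u' v' u v p q where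
  hq := h.hp
  hp := h.hq
  uu k hk l hl := by rw [eq_comm, h.uu l hl k hk, and_comm]
  uv k hk l hl := by rw [eq_comm, h.vu l hl k hk, and_comm]
  vu k hk l hl := by rw [eq_comm, h.uv l hl k hk, and_comm]
  vv k hk l hl := by rw [eq_comm, h.vv l hl k hk, and_comm]

lemma Crossing.height_diff (h : Crossing N u v u' v' q p) (x : KPf) :
    height u' v' x (p + 1) - height u' v' x p = height u v x q - height u v x (q + 1) := by
  have hq := h.hq
  have hp := h.hp
  rw [height_succ, height_succ, ← (h.uv (q + 1) hq p (by omega)).2 ⟨rfl, rfl⟩,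
    ← (h.vu q (by omega) (p + 1) hp).2 ⟨rfl, rfl⟩]
  ring

lemma Crossing.apply_u (h : Crossing N u v u' v' q p) {σ : ℤ} (hk : k < N) (hl : l < N)
    (hxy : Shift u v σ k x y) :
    (y (u' l) : ℤ) = x (u' l) + σ * ((if k = q ∧ l = p + 1 then 1 else 0) -
      (if k = q ∧ l = p then 1 else 0)) := by
  rw [hxy]
  simp only [eq_comm (a := u' l), h.uu k hk l hl, h.vu k hk l hl]

lemma Crossing.apply_v (h : Crossing N u v u' v' q p) {σ : ℤ} (hk : k < N) (hl : l < N)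
    (hxy : Shift u v σ k x y) :
    (y (v' l) : ℤ) = x (v' l) + σ * ((if k = q + 1 ∧ l = p + 1 then 1 else 0) -
      (if k = q + 1 ∧ l = p then 1 else 0)) := by
  rw [hxy]
  simp only [eq_comm (a := v' l), h.uv k hk l hl, h.vv k hk l hl]

lemma Crossing.excess_shift (h : Crossing N u v u' v' q p) {σ : ℤ} (hk : k < N) (hl : l ≤ N)
    (hxy : Shift u v σ k x y) :
    excess u' v' y l = excess u' v' x l + σ * ((if k = q + 1 ∧ l = p + 1 then 1 else 0) -
      (if k = q ∧ l = p + 1 then 1 else 0)) := by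
  induction l with
  | zero => simp [excess_zero]
  | succ l ih =>
    rw [excess_succ, excess_succ, ih (by omega), h.apply_u hk hl hxy, h.apply_v hk hl hxy]
    by_cases h1 : k = q
    · by_cases h2 : l = p
      · simp [h1, h2]; ring
      · by_cases h3 : l = p + 1 <;> simp [h1, h2, h3]; ring
    · by_cases h1' : k = q + 1
      · by_cases h2 : l = p
        · simp [h1', h2]; ring
        · by_cases h3 : l = p + 1 <;> simp [h1', h2, h3]; ring
      · simp [h1, h1']

lemma Crossing.height_shift (h : Crossing N u v u' v' q p) {σ : ℤ} (hk : k < N) (hl : l < N)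
    (hxy : Shift u v σ k x y) :
    height u' v' y l = height u' v' x l + σ * ((if k = q + 1 ∧ l = p + 1 then 1 else 0) -
      (if k = q ∧ l = p then 1 else 0)) := by
  rw [height, height, h.excess_shift hk hl.le hxy, h.apply_u hk hl hxy]
  ring

lemma Crossing.excess_eq (h : Crossing N u v u' v' q p) {σ : ℤ} (hk : k < N)
    (hxy : Shift u v σ k x y) : excess u' v' y N = excess u' v' x N := by
  have := h.hp
  rw [h.excess_shift hk le_rfl hxy, if_neg (by omega), if_neg (by omega)]
  ring

lemma Crossing.isMaxHeight_of_fPos (h : Crossing N u v u' v' q p) (hk : FPos u v N x k) {m : ℤ}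
    (hm : IsMaxHeight u' v' N x m) : IsMaxHeight u' v' N (KPmove x (u k) (v k)) m := by
  have hd := h.height_diff x
  have hq := h.hq
  have hp := h.hp
  have hy := fun l (hl : l < N) => h.height_shift hk.1 hl hk.shift
  obtain ⟨⟨l, hl, rfl⟩, hle⟩ := hm
  obtain ⟨hkN, h1, h2, h3⟩ := hk
  have h1q := h1 q
  have h2q := h2 (q + 1) hq
  have hlp := hle p (by omega)
  have hlp' := hle (p + 1) hp
  constructor
  · by_cases hs : k = q ∧ l = p
    · refine ⟨p + 1, hp, ?_⟩
      rw [hy _ hp]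
      grind
    · refine ⟨l, hl, ?_⟩
      rw [hy l hl]
      grind
  · intro a ha
    have := hle a ha
    rw [hy a ha]
    grind

lemma Crossing.isMaxHeight_of_ePos (h : Crossing N u v u' v' q p) (hk : EPos u v N x k) {m : ℤ}
    (hm : IsMaxHeight u' v' N x m) : IsMaxHeight u' v' N (KPmove x (v k) (u k)) m := by
  have hd := h.height_diff x
  have hq := h.hq
  have hp := h.hp
  have hy := fun l (hl : l < N) => h.height_shift hk.1 hl hk.shift
  obtain ⟨⟨l, hl, rfl⟩, hle⟩ := hm
  obtain ⟨hkN, h1, h2, h3⟩ := hk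
  have h1q := h1 (q + 1) hq
  have h2q := h2 q (by omega)
  have hlp := hle p (by omega)
  have hlp' := hle (p + 1) hp
  constructor
  · by_cases hs : k = q + 1 ∧ l = p + 1
    · refine ⟨p, by omega, ?_⟩
      rw [hy _ (by omega)]
      grind
    · refine ⟨l, hl, ?_⟩
      rw [hy l hl]
      grind
  · intro a ha
    have := hle a ha
    rw [hy a ha]
    grind

lemma Shift.comm {σ σ' : ℤ} (hxy : Shift u v σ k x y) (hyw : Shift u' v' σ' l y w)
    (hxz : Shift u' v' σ' l x z) (hzw : Shift u v σ k z w') : w = w' := by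
  funext r
  have h1 := hxy r
  have h2 := hyw r
  have h3 := hxz r
  have h4 := hzw r
  omega

lemma Crossing.comm_fPos_fPos (h : Crossing N u v u' v' q p) (hk : FPos u v N x k)
    (hl : FPos u' v' N x l) :
    ∃ k' l', FPos u' v' N (KPmove x (u k) (v k)) l' ∧ FPos u v N (KPmove x (u' l) (v' l)) k' ∧
      KPmove (KPmove x (u k) (v k)) (u' l') (v' l') =
        KPmove (KPmove x (u' l) (v' l)) (u k') (v k') := by
  have hd := h.height_diff x
  have hq := h.hq
  have hp := h.hp
  have hxy := hk.shift
  have hxz := hl.shift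
  have hy := fun a (ha : a < N) => h.height_shift hk.1 ha hxy
  have hz := fun a (ha : a < N) => h.symm.height_shift hl.1 ha hxz
  generalize KPmove x (u k) (v k) = y at *
  generalize KPmove x (u' l) (v' l) = z at *
  obtain ⟨hkN, h1, h2, h3⟩ := hk
  obtain ⟨hlN, h1', h2', h3'⟩ := hl
  by_cases hs : k = q ∧ l = p ∧ height u v x q = height u v x (q + 1)
  · obtain ⟨rfl, rfl, hs⟩ := hs
    have hf : FPos u' v' N y (l + 1) := by
      refine ⟨hp, fun a ha => ?_, fun a ha => ?_, ?_⟩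
      · have := h2' a (by omega)
        grind
      · have := h2' a ha
        grind
      · grind
    have hf' : FPos u v N z (k + 1) := by
      refine ⟨hq, fun a ha => ?_, fun a ha => ?_, ?_⟩
      · have := h2 a (by omega)
        grind
      · have := h2 a ha
        grind
      · grind
    refine ⟨k + 1, l + 1, hf, hf', ?_⟩
    have hyw := hf.shift
    have hzw := hf'.shift
    funext r
    have e1 := hxy r
    have e2 := hxz r
    have e3 := hyw r
    have e4 := hzw r
    rw [← (h.vu k hkN (l + 1) hp).2 ⟨rfl, rfl⟩, ← (h.vv (k + 1) hq (l + 1) hp).2 ⟨rfl, rfl⟩]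
      at e3 ⊢
    rw [← (h.uu k hkN l hlN).2 ⟨rfl, rfl⟩, ← (h.uv (k + 1) hq l hlN).2 ⟨rfl, rfl⟩] at e2
    omega
  · have a1 := h1 q
    have a2 := h2 (q + 1) hq
    have b1 := h1' p
    have b2 := h2' (p + 1) hp
    have hf : FPos u' v' N y l := by
      refine ⟨hlN, fun a ha => ?_, fun a ha => ?_, ?_⟩
      · have := h1' a ha
        rw [hy a (by omega), hy l hlN]
        grind
      · have := h2' a ha
        rw [hy a ha, hy l hlN]
        grind
      · rw [hy l hlN]
        grind
    have hf' : FPos u v N z k := by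
      refine ⟨hkN, fun a ha => ?_, fun a ha => ?_, ?_⟩
      · have := h1 a ha
        rw [hz a (by omega), hz k hkN]
        grind
      · have := h2 a ha
        rw [hz a ha, hz k hkN]
        grind
      · rw [hz k hkN]
        grind
    exact ⟨k, l, hf, hf', hxy.comm hf.shift hxz hf'.shift⟩

lemma Crossing.comm_fPos_ePos (h : Crossing N u v u' v' q p) (hk : FPos u v N x k)
    (hl : EPos u' v' N x l) :
    ∃ k' l', EPos u' v' N (KPmove x (u k) (v k)) l' ∧ FPos u v N (KPmove x (v' l) (u' l)) k' ∧
      KPmove (KPmove x (u k) (v k)) (v' l') (u' l') =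
        KPmove (KPmove x (v' l) (u' l)) (u k') (v k') ∧
      (l' = l ∨ l = p ∧ l' = p + 1) := by
  have hd := h.height_diff x
  have hq := h.hq
  have hp := h.hp
  have hxy := hk.shift
  have hxz := hl.shift
  have hy := fun a (ha : a < N) => h.height_shift hk.1 ha hxy
  have hz := fun a (ha : a < N) => h.symm.height_shift hl.1 ha hxz
  have hye := h.excess_eq hk.1 hxy
  generalize KPmove x (u k) (v k) = y at *
  generalize KPmove x (v' l) (u' l) = z at *
  obtain ⟨hkN, h1, h2, h3⟩ := hk
  obtain ⟨hlN, h1', h2', h3'⟩ := hl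
  by_cases hs : k = q + 1 ∧ l = p ∧ height u v x q + 1 = height u v x (q + 1)
  · obtain ⟨rfl, rfl, hs⟩ := hs
    have hqN : q < N := by omega
    have hf : EPos u' v' N y (l + 1) := by
      refine ⟨hp, fun a ha hla => ?_, fun a ha => ?_, ?_⟩
      · have := h1' a ha (by omega)
        grind
      · have := h2' a ha
        grind
      · grind
    have hf' : FPos u v N z q := by
      refine ⟨hqN, fun a ha => ?_, fun a ha => ?_, ?_⟩
      · have := h1 a (by omega)
        grind
      · have := h2 a ha
        grind
      · grind
    refine ⟨q, l + 1, hf, hf', ?_, Or.inr ⟨rfl, rfl⟩⟩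
    have hyw := hf.shift
    have hzw := hf'.shift
    funext r
    have e1 := hxy r
    have e2 := hxz r
    have e3 := hyw r
    have e4 := hzw r
    rw [← (h.vu q hqN (l + 1) hp).2 ⟨rfl, rfl⟩, ← (h.vv (q + 1) hq (l + 1) hp).2 ⟨rfl, rfl⟩]
      at e3 ⊢
    rw [← (h.uu q hqN l hlN).2 ⟨rfl, rfl⟩, ← (h.uv (q + 1) hq l hlN).2 ⟨rfl, rfl⟩] at e2
    omega
  · have a1 := h1 q
    have a2 := h2 (q + 1) hq
    have b1 := h1' (p + 1) hp
    have b2 := h2' p (by omega)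
    have hf : EPos u' v' N y l := by
      refine ⟨hlN, fun a ha hla => ?_, fun a ha => ?_, ?_⟩
      · have := h1' a ha hla
        rw [hy a (by omega), hy l hlN]
        grind
      · have := h2' a ha
        rw [hy a ha, hy l hlN]
        grind
      · rw [hy l hlN, hye]
        grind
    have hf' : FPos u v N z k := by
      refine ⟨hkN, fun a ha => ?_, fun a ha => ?_, ?_⟩
      · have := h1 a ha
        rw [hz a (by omega), hz k hkN]
        grind
      · have := h2 a ha
        rw [hz a ha, hz k hkN]
        grind
      · rw [hz k hkN]
        grind
    exact ⟨k, l, hf, hf', hxy.comm hf.shift hxz hf'.shift, Or.inl rfl⟩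

end Shift

/-! ### Commuting partial operators -/

/-- The relation `f̃` attached to a family of blocks, without creation of roots. -/
def FRel (u v : ℕ → Root) (N : ℕ) (x y : KPf) : Prop :=
  ∃ k, FPos u v N x k ∧ y = KPmove x (u k) (v k)

/-- The relation `ẽ` attached to a family of blocks, undefined when the root to be moved
is `s`. -/
def ERel (s : Root) (u v : ℕ → Root) (N : ℕ) (x y : KPf) : Prop :=
  ∃ k, EPos u v N x k ∧ v k ≠ s ∧ y = KPmove x (v k) (u k)

/-- `x` and `y` coincide on the roots of a family of blocks. -/
def Agree (u v : ℕ → Root) (N : ℕ) (x y : KPf) : Prop :=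
  ∀ k < N, y (u k) = x (u k) ∧ y (v k) = x (v k)

section Operators

variable {n N : ℕ} {u v u' v' : ℕ → Root} {x y z w : KPf} {s : Root}

lemma Agree.symm (h : Agree u v N x y) : Agree u v N y x :=
  fun k hk => ⟨(h k hk).1.symm, (h k hk).2.symm⟩

lemma Agree.excess_eq (h : Agree u v N x y) {k : ℕ} (hk : k ≤ N) :
    excess u v y k = excess u v x k :=
  Finset.sum_congr rfl fun l hl => by
    have := Finset.mem_range.1 hl
    rw [(h l (by omega)).1, (h l (by omega)).2]

lemma Agree.height_eq (h : Agree u v N x y) {k : ℕ} (hk : k < N) :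
    height u v y k = height u v x k := by
  rw [height, height, h.excess_eq hk.le, (h k hk).1]

lemma Agree.isMaxHeight (h : Agree u v N x y) {m : ℤ} (hm : IsMaxHeight u v N x m) :
    IsMaxHeight u v N y m := by
  obtain ⟨⟨k, hk, rfl⟩, hle⟩ := hm
  exact ⟨⟨k, hk, h.height_eq hk⟩, fun l hl => (h.height_eq hl).trans_le (hle l hl)⟩

lemma Agree.fPos (h : Agree u v N x y) {k : ℕ} (hk : FPos u v N x k) : FPos u v N y k := by
  obtain ⟨h1, h2, h3, h4⟩ := hk
  refine ⟨h1, fun l hl => ?_, fun l hl => ?_, ?_⟩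
  · rw [h.height_eq (hl.trans h1), h.height_eq h1]
    exact h2 l hl
  · rw [h.height_eq hl, h.height_eq h1]
    exact h3 l hl
  · rwa [h.height_eq h1]

lemma Agree.ePos (h : Agree u v N x y) {k : ℕ} (hk : EPos u v N x k) : EPos u v N y k := by
  obtain ⟨h1, h2, h3, h4⟩ := hk
  refine ⟨h1, fun l hl hkl => ?_, fun l hl => ?_, ?_⟩
  · rw [h.height_eq hl, h.height_eq h1]
    exact h2 l hl hkl
  · rw [h.height_eq hl, h.height_eq h1]
    exact h3 l hl
  · rwa [h.height_eq h1, h.excess_eq le_rfl]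

/-- An operator moving one root inside one block, which only depends on the multiplicities of
the roots in the blocks, and which moves positive roots to positive roots. -/
structure IsLocalOp (n N : ℕ) (u v : ℕ → Root) (R : KPf → KPf → Prop) : Prop where
  proper : ∀ x y, IsKP n x → R x y →
    ∃ k < N, ∃ σ, Shift u v σ k x y ∧ IsPos n (u k) ∧ IsPos n (v k)
  functional : ∀ x y y', R x y → R x y' → y = y'
  congr : ∀ x y x', R x y → Agree u v N x x' →
    ∃ y', R x' y' ∧ ∃ k σ, Shift u v σ k x y ∧ Shift u v σ k x' y'

lemma isLocalOp_fRel (h : ∀ k < N, IsPos n (u k) → IsPos n (v k)) :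
    IsLocalOp n N u v (FRel u v N) where
  proper := by
    rintro x _ hx ⟨k, hk, rfl⟩
    have h1 := hx _ hk.pos.ne'
    exact ⟨k, hk.1, 1, hk.shift, h1, h k hk.1 h1⟩
  functional := by
    rintro x _ _ ⟨k, hk, rfl⟩ ⟨k', hk', rfl⟩
    rw [hk.unique hk']
  congr := by
    rintro x _ x' ⟨k, hk, rfl⟩ ha
    exact ⟨_, ⟨k, ha.fPos hk, rfl⟩, k, 1, hk.shift, (ha.fPos hk).shift⟩

lemma isLocalOp_eRel (h : ∀ k < N, IsPos n (v k) → v k ≠ s → IsPos n (u k)) :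
    IsLocalOp n N u v (ERel s u v N) where
  proper := by
    rintro x _ hx ⟨k, hk, hs, rfl⟩
    have h1 := hx _ hk.pos.ne'
    exact ⟨k, hk.1, -1, hk.shift, h k hk.1 h1 hs, h1⟩
  functional := by
    rintro x _ _ ⟨k, hk, -, rfl⟩ ⟨k', hk', -, rfl⟩
    rw [hk.unique hk']
  congr := by
    rintro x _ x' ⟨k, hk, hs, rfl⟩ ha
    exact ⟨_, ⟨k, ha.ePos hk, hs, rfl⟩, k, -1, hk.shift, (ha.ePos hk).shift⟩

lemma IsLocalOp.isKP {R : KPf → KPf → Prop} (hR : IsLocalOp n N u v R) (hx : IsKP n x)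
    (h : R x y) : IsKP n y := by
  obtain ⟨k, -, σ, hs, hu, hv⟩ := hR.proper x y hx h
  intro r hr
  by_cases h1 : r = u k
  · rwa [h1]
  by_cases h2 : r = v k
  · rwa [h2]
  refine hx r fun h0 => hr ?_
  have := hs r
  simp only [h1, h2, if_false] at this
  omega

/-- No positive root belongs to both families of blocks. -/
def Disj (n N : ℕ) (u v u' v' : ℕ → Root) : Prop :=
  ∀ r, IsPos n r → (∃ k < N, r = u k ∨ r = v k) → ¬ ∃ l < N, r = u' l ∨ r = v' l

lemma Disj.symm (h : Disj n N u v u' v') : Disj n N u' v' u v :=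
  fun r hr h1 h2 => h r hr h2 h1

lemma Disj.agree {R : KPf → KPf → Prop} (h : Disj n N u v u' v') (hR : IsLocalOp n N u v R)
    (hx : IsKP n x) (hxy : R x y) : Agree u' v' N x y := by
  obtain ⟨k, hk, σ, hs, hu, hv⟩ := hR.proper x y hx hxy
  have hu' := h _ hu ⟨k, hk, Or.inl rfl⟩
  have hv' := h _ hv ⟨k, hk, Or.inr rfl⟩
  refine fun l hl => ⟨hs.congr (r := u') ?_ ?_, hs.congr (r := v') ?_ ?_⟩
  · exact fun e => hu' ⟨l, hl, Or.inl e.symm⟩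
  · exact fun e => hv' ⟨l, hl, Or.inl e.symm⟩
  · exact fun e => hu' ⟨l, hl, Or.inr e.symm⟩
  · exact fun e => hv' ⟨l, hl, Or.inr e.symm⟩

/-- Where `G` is defined, it commutes with `H` and preserves the domain of `H`. -/
def Commuting (n : ℕ) (G H : KPf → KPf → Prop) : Prop :=
  ∀ x y, IsKP n x → G x y →
    (∀ w, H y w → ∃ z, H x z ∧ G z w) ∧ (∀ z, H x z → ∃ w, H y w ∧ G z w)

/-- `G` preserves the signature of the reduced words attached to a family of blocks. -/
def Keeps (n N : ℕ) (G : KPf → KPf → Prop) (u v : ℕ → Root) : Prop :=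
  ∀ x y, IsKP n x → G x y →
    (∀ m, IsMaxHeight u v N x m → IsMaxHeight u v N y m) ∧ excess u v y N = excess u v x N

lemma Disj.keeps {R : KPf → KPf → Prop} (h : Disj n N u v u' v') (hR : IsLocalOp n N u v R) :
    Keeps n N R u' v' := fun _ _ hx hxy =>
  ⟨fun _ => (h.agree hR hx hxy).isMaxHeight, (h.agree hR hx hxy).excess_eq le_rfl⟩

lemma Disj.commuting {G H : KPf → KPf → Prop} (h : Disj n N u v u' v')
    (hG : IsLocalOp n N u v G) (hH : IsLocalOp n N u' v' H) : Commuting n G H := by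
  intro x y hx hxy
  have hxy' := h.agree hG hx hxy
  have key : ∀ z, H x z → ∃ w, H y w ∧ G z w := by
    intro z hxz
    obtain ⟨w, hw, k, σ, h1, h2⟩ := hH.congr x z y hxz hxy'
    obtain ⟨w', hw', k', σ', h1', h2'⟩ := hG.congr x y z hxy (h.symm.agree hH hx hxz)
    obtain rfl := h1'.comm h2 h1 h2'
    exact ⟨w, hw, hw'⟩
  refine ⟨fun w hw => ?_, key⟩
  obtain ⟨z, hz, -⟩ := hH.congr y w x hw hxy'.symm
  obtain ⟨w', hw', hzw'⟩ := key z hz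
  exact ⟨z, hz, hH.functional y w w' hw hw' ▸ hzw'⟩

lemma Crossing.keeps_fRel {q p : ℕ} (h : Crossing N u v u' v' q p) :
    Keeps n N (FRel u v N) u' v' := by
  rintro x _ - ⟨k, hk, rfl⟩
  exact ⟨fun m => h.isMaxHeight_of_fPos hk, h.excess_eq hk.1 hk.shift⟩

lemma Crossing.keeps_eRel {q p : ℕ} (h : Crossing N u v u' v' q p) :
    Keeps n N (ERel s u v N) u' v' := by
  rintro x _ - ⟨k, hk, -, rfl⟩
  exact ⟨fun m => h.isMaxHeight_of_ePos hk, h.excess_eq hk.1 hk.shift⟩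

lemma Crossing.commuting_fRel_fRel {q p : ℕ} (h : Crossing N u v u' v' q p) :
    Commuting n (FRel u v N) (FRel u' v' N) := by
  intro x y hx hxy
  obtain ⟨hm, -⟩ := h.keeps_fRel x y hx hxy
  obtain ⟨k, hk, rfl⟩ := hxy
  constructor
  · rintro w ⟨l', hl', rfl⟩
    have hmax := isMaxHeight_plusCt (u := u') (v := v') (x := x) (Nat.zero_lt_of_lt h.hq)
    obtain ⟨l, hl⟩ := hmax.exists_fPos ((hm _ hmax).unique hl'.isMaxHeight ▸ hl'.2.2.2)
    obtain ⟨k', l'', hl'', hk', e⟩ := h.comm_fPos_fPos hk hl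
    obtain rfl := hl'.unique hl''
    exact ⟨_, ⟨l, hl, rfl⟩, k', hk', e⟩
  · rintro z ⟨l, hl, rfl⟩
    obtain ⟨k', l', hl', hk', e⟩ := h.comm_fPos_fPos hk hl
    exact ⟨_, ⟨l', hl', rfl⟩, k', hk', e⟩

lemma Crossing.commuting_fRel_eRel {q p : ℕ} (h : Crossing N u v u' v' q p)
    (hs : v' p ≠ s) (hs' : v' (p + 1) ≠ s) :
    Commuting n (FRel u v N) (ERel s u' v' N) := by
  intro x y hx hxy
  obtain ⟨hm, hex⟩ := h.keeps_fRel x y hx hxy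
  obtain ⟨k, hk, rfl⟩ := hxy
  constructor
  · rintro w ⟨l', hl', hls, rfl⟩
    have hmax := isMaxHeight_plusCt (u := u') (v := v') (x := x) (Nat.zero_lt_of_lt h.hq)
    obtain ⟨l, hl⟩ := hmax.exists_ePos
      (hex ▸ (hm _ hmax).unique hl'.isMaxHeight ▸ hl'.2.2.2)
    obtain ⟨k', l'', hl'', hk', e, hcases⟩ := h.comm_fPos_ePos hk hl
    obtain rfl := hl'.unique hl''
    refine ⟨_, ⟨l, hl, ?_, rfl⟩, k', hk', e⟩
    rcases hcases with rfl | ⟨rfl, -⟩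
    · exact hls
    · exact hs
  · rintro z ⟨l, hl, hls, rfl⟩
    obtain ⟨k', l', hl', hk', e, hcases⟩ := h.comm_fPos_ePos hk hl
    refine ⟨_, ⟨l', hl', ?_, rfl⟩, k', hk', e⟩
    rcases hcases with rfl | ⟨-, rfl⟩
    · exact hls
    · exact hs'

lemma Keeps.plusCt_eq {G : KPf → KPf → Prop} (h : Keeps n N G u v) (hN : 0 < N)
    (hx : IsKP n x) (hxy : G x y) :
    plusCt (reduceW (blockWord u v N y)) = plusCt (reduceW (blockWord u v N x)) := by
  have := (h x y hx hxy).1 _ (isMaxHeight_plusCt hN)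
  exact_mod_cast (isMaxHeight_plusCt hN).unique this

lemma Keeps.minusCt_eq {G : KPf → KPf → Prop} (h : Keeps n N G u v) (hN : 0 < N)
    (hx : IsKP n x) (hxy : G x y) :
    minusCt (reduceW (blockWord u v N y)) = minusCt (reduceW (blockWord u v N x)) := by
  have h1 := KFC.minusCt_eq (u := u) (v := v) (N := N) (x := x)
  have h2 := KFC.minusCt_eq (u := u) (v := v) (N := N) (x := y)
  rw [h.plusCt_eq hN hx hxy, (h x y hx hxy).2] at h2
  omega

/-- The operator acting as `R₁` where the condition `c` holds, and as `R₂` elsewhere. -/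
def Branch (c : KPf → Prop) (R₁ R₂ : KPf → KPf → Prop) (x y : KPf) : Prop :=
  (c x ∧ R₁ x y) ∨ (¬ c x ∧ R₂ x y)

/-- `G` does not change the truth value of `c`. -/
def Respects (n : ℕ) (G : KPf → KPf → Prop) (c : KPf → Prop) : Prop :=
  ∀ x y, IsKP n x → G x y → (c y ↔ c x)

lemma Commuting.branch_right {G H₁ H₂ : KPf → KPf → Prop} {c : KPf → Prop}
    (h₁ : Commuting n G H₁) (h₂ : Commuting n G H₂) (hc : Respects n G c) :
    Commuting n G (Branch c H₁ H₂) := by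
  intro x y hx hxy
  have hc' := hc x y hx hxy
  constructor
  · rintro w (⟨hcw, hw⟩ | ⟨hcw, hw⟩)
    · obtain ⟨z, hz, hzw⟩ := (h₁ x y hx hxy).1 w hw
      exact ⟨z, Or.inl ⟨hc'.1 hcw, hz⟩, hzw⟩
    · obtain ⟨z, hz, hzw⟩ := (h₂ x y hx hxy).1 w hw
      exact ⟨z, Or.inr ⟨mt hc'.2 hcw, hz⟩, hzw⟩
  · rintro z (⟨hcz, hz⟩ | ⟨hcz, hz⟩)
    · obtain ⟨w, hw, hzw⟩ := (h₁ x y hx hxy).2 z hz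
      exact ⟨w, Or.inl ⟨hc'.2 hcz, hw⟩, hzw⟩
    · obtain ⟨w, hw, hzw⟩ := (h₂ x y hx hxy).2 z hz
      exact ⟨w, Or.inr ⟨mt hc'.1 hcz, hw⟩, hzw⟩

lemma Commuting.branch_left {G₁ G₂ H : KPf → KPf → Prop} {c : KPf → Prop}
    (h₁ : Commuting n G₁ H) (h₂ : Commuting n G₂ H) (hc : Respects n H c) :
    Commuting n (Branch c G₁ G₂) H := by
  rintro x y hx (⟨hcx, hxy⟩ | ⟨hcx, hxy⟩)
  · obtain ⟨h, h'⟩ := h₁ x y hx hxy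
    refine ⟨fun w hw => ?_, fun z hz => ?_⟩
    · obtain ⟨z, hz, hzw⟩ := h w hw
      exact ⟨z, hz, Or.inl ⟨(hc x z hx hz).2 hcx, hzw⟩⟩
    · obtain ⟨w, hw, hzw⟩ := h' z hz
      exact ⟨w, hw, Or.inl ⟨(hc x z hx hz).2 hcx, hzw⟩⟩
  · obtain ⟨h, h'⟩ := h₂ x y hx hxy
    refine ⟨fun w hw => ?_, fun z hz => ?_⟩
    · obtain ⟨z, hz, hzw⟩ := h w hw
      exact ⟨z, hz, Or.inr ⟨mt (hc x z hx hz).1 hcx, hzw⟩⟩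
    · obtain ⟨w, hw, hzw⟩ := h' z hz
      exact ⟨w, hw, Or.inr ⟨mt (hc x z hx hz).1 hcx, hzw⟩⟩

lemma Respects.branch {G₁ G₂ : KPf → KPf → Prop} {c c' : KPf → Prop}
    (h₁ : Respects n G₁ c) (h₂ : Respects n G₂ c) : Respects n (Branch c' G₁ G₂) c := by
  rintro x y hx (⟨-, h⟩ | ⟨-, h⟩)
  · exact h₁ x y hx h
  · exact h₂ x y hx h

end Operators

/-! ### The words `W_i` and `W_i*` -/

/-- The roots marked `+` in `W_i` (if `b`) or in `W_i*` (if not `b`). -/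
def plusRoot (n i : ℕ) (b : Bool) (k : ℕ) : Root := if b then (n - k, i) else (i + 1, k)

/-- The roots marked `-` in `W_i` (if `b`) or in `W_i*` (if not `b`). -/
def minusRoot (n i : ℕ) (b : Bool) (k : ℕ) : Root := if b then (n - k, i + 1) else (i, k)

lemma Wstar_eq (n i : ℕ) (x : KPf) :
    Wstar n i x = blockWord (plusRoot n i false) (minusRoot n i false) (n + 1) x := rfl

lemma Wword_eq (n i : ℕ) (x : KPf) :
    Wword n i x = blockWord (plusRoot n i true) (minusRoot n i true) (n + 1) x := by
  have h : (List.range (n + 1)).reverse = (List.range (n + 1)).map (fun k => n - k) := by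
    refine List.ext_getElem (by simp) fun k _ _ => ?_
    simp
  simp [Wword, blockWord, h, List.flatMap_map, plusRoot, minusRoot]

/-- The operator `f̃_i` (if `b`) or `f̃_i*` (if not `b`), without creation of roots. -/
def fRelOf (n i : ℕ) (b : Bool) : KPf → KPf → Prop :=
  FRel (plusRoot n i b) (minusRoot n i b) (n + 1)

/-- The operator `ẽ_i` (if `b`) or `ẽ_i*` (if not `b`), without deletion of roots. -/
def eRelOf (n i : ℕ) (b : Bool) : KPf → KPf → Prop :=
  ERel (i, i + 1) (plusRoot n i b) (minusRoot n i b) (n + 1)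

lemma fop_eq_some (n i : ℕ) (x y : KPf) :
    fop n i x = some y ↔
      Branch (fun x => bStar n i x < aSt n i x) (fRelOf n i true) (fRelOf n i false) x y := by
  unfold fop Branch
  by_cases hc : bStar n i x < aSt n i x
  · have ha : lastPlus (Wword n i x) ≠ none := by
      rw [Wword_eq, ← plusCt_pos_iff, ← Wword_eq]
      exact Nat.zero_lt_of_lt hc
    obtain ⟨r, hr⟩ := Option.ne_none_iff_exists'.1 ha
    simp only [hc, if_true, true_and, not_true_eq_false, false_and, or_false, ftilde, hr,
      Option.some.injEq]
    rw [Wword_eq] at hr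
    obtain ⟨k, hk, rfl⟩ := lastPlus_eq_some.1 hr
    constructor
    · rintro rfl
      exact ⟨k, hk, rfl⟩
    · rintro ⟨k', hk', rfl⟩
      rw [hk.unique hk']
      rfl
  · simp only [hc, if_false, false_and, not_false_eq_true, true_and, false_or]
    have ha : 0 < aStar n i x ↔ lastPlus (Wstar n i x) ≠ none := by
      rw [aStar, Wstar_eq, plusCt_pos_iff]
    have hl : ∀ r, lastPlus (Wstar n i x) = some r ↔
        ∃ k, FPos (plusRoot n i false) (minusRoot n i false) (n + 1) x k ∧ plusRoot n i false k = r :=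
      fun r => by rw [Wstar_eq, lastPlus_eq_some]
    rcases ho : lastPlus (Wstar n i x) with _ | r
    · rw [if_neg (by simp [ha, ho])]
      simp only [reduceCtorEq, false_iff]
      rintro ⟨k, hk, -⟩
      have := (hl _).2 ⟨k, hk, rfl⟩
      simp [ho] at this
    · rw [if_pos (by simp [ha, ho])]
      obtain ⟨k, hk, rfl⟩ := (hl r).1 ho
      simp only [ftildeS, ho, Option.some.injEq]
      constructor
      · rintro rfl
        exact ⟨k, hk, rfl⟩
      · rintro ⟨k', hk', rfl⟩
        rw [hk.unique hk']
        rfl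

lemma eop_eq_some (n i : ℕ) (x y : KPf) :
    eop n i x = some y ↔
      Branch (fun x => bStar n i x ≤ aSt n i x) (eRelOf n i true) (eRelOf n i false) x y := by
  unfold eop Branch
  by_cases hc : bStar n i x ≤ aSt n i x
  · simp only [hc, if_true, true_and, not_true_eq_false, false_and, or_false]
    have hb : 0 < bSt n i x ↔ headMinus (Wword n i x) ≠ none := by
      rw [bSt, Wword_eq, minusCt_pos_iff]
    have hl : ∀ r, headMinus (Wword n i x) = some r ↔
        ∃ k, EPos (plusRoot n i true) (minusRoot n i true) (n + 1) x k ∧ minusRoot n i true k = r :=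
      fun r => by rw [Wword_eq, headMinus_eq_some]
    simp only [hb]
    rcases ho : headMinus (Wword n i x) with _ | r
    · simp only [ne_eq, not_true_eq_false, false_and, if_false, reduceCtorEq, false_iff]
      rintro ⟨k, hk, -⟩
      have := (hl _).2 ⟨k, hk, rfl⟩
      simp [ho] at this
    · obtain ⟨k, hk, rfl⟩ := (hl r).1 ho
      by_cases hs : minusRoot n i true k = (i, i + 1)
      · simp only [hs, ne_eq, not_true_eq_false, and_false, if_false, reduceCtorEq, false_iff]
        rintro ⟨k', hk', hs', -⟩
        exact hs' (hk.unique hk' ▸ hs)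
      · simp only [ne_eq, reduceCtorEq, not_false_eq_true, Option.some.injEq, hs, and_self,
          if_true, etilde, ho, if_false]
        constructor
        · rintro rfl
          exact ⟨k, hk, hs, rfl⟩
        · rintro ⟨k', hk', -, rfl⟩
          rw [hk.unique hk']
          rfl
  · simp only [hc, if_false, false_and, not_false_eq_true, true_and, false_or]
    have hb : headMinus (Wstar n i x) ≠ none := by
      rw [Wstar_eq, ← minusCt_pos_iff, ← Wstar_eq]
      exact Nat.zero_lt_of_lt (not_le.1 hc)
    obtain ⟨r, hr⟩ := Option.ne_none_iff_exists'.1 hb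
    have hr' := hr
    rw [Wstar_eq] at hr'
    obtain ⟨k, hk, rfl⟩ := headMinus_eq_some.1 hr'
    by_cases hs : minusRoot n i false k = (i, i + 1)
    · simp only [hr, hs, ne_eq, not_true_eq_false, if_false, reduceCtorEq, false_iff]
      rintro ⟨k', hk', hs', -⟩
      exact hs' (hk.unique hk' ▸ hs)
    · simp only [hr, ne_eq, not_false_eq_true, Option.some.injEq, hs,
        if_true, etildeS, if_false]
      constructor
      · rintro rfl
        exact ⟨k, hk, hs, rfl⟩
      · rintro ⟨k', hk', -, rfl⟩
        rw [hk.unique hk']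
        rfl

section Orthogonal

variable {n i j : ℕ}

lemma isLocalOp_fRelOf (hi : 1 ≤ i) (hi' : i < n) (b : Bool) :
    IsLocalOp n (n + 1) (plusRoot n i b) (minusRoot n i b) (fRelOf n i b) := by
  refine isLocalOp_fRel fun k hk => ?_
  cases b <;> simp only [plusRoot, minusRoot, IsPos, if_true, Bool.false_eq_true, if_false] <;>
    omega

lemma isLocalOp_eRelOf (hi : 1 ≤ i) (hi' : i < n) (b : Bool) :
    IsLocalOp n (n + 1) (plusRoot n i b) (minusRoot n i b) (eRelOf n i b) := by
  refine isLocalOp_eRel fun k hk => ?_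
  cases b <;> simp only [plusRoot, minusRoot, IsPos, if_true, Bool.false_eq_true, if_false,
    ne_eq, Prod.mk.injEq, true_and, and_true] <;> omega

lemma crossing_row_col (hi : 1 ≤ i) (hj : j < n) (hij : i + 1 < j) :
    Crossing (n + 1) (plusRoot n i false) (minusRoot n i false)
      (plusRoot n j true) (minusRoot n j true) j (n - (i + 1)) := by
  refine ⟨by omega, by omega, ?_, ?_, ?_, ?_⟩ <;> intro k hk l hl <;>
    simp only [plusRoot, minusRoot, if_true, Bool.false_eq_true, if_false, Prod.mk.injEq] <;> omega

lemma disj_or_crossing (hi : 1 ≤ i) (hi' : i < n) (hj : 1 ≤ j) (hj' : j < n)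
    (hij : i + 1 < j ∨ j + 1 < i) (b c : Bool) :
    Disj n (n + 1) (plusRoot n i b) (minusRoot n i b) (plusRoot n j c) (minusRoot n j c) ∨
    ∃ q p, Crossing (n + 1) (plusRoot n i b) (minusRoot n i b)
        (plusRoot n j c) (minusRoot n j c) q p ∧
      minusRoot n j c p ≠ (j, j + 1) ∧ minusRoot n j c (p + 1) ≠ (j, j + 1) := by
  by_cases h1 : b = false ∧ c = true ∧ i + 1 < j
  · obtain ⟨rfl, rfl, h⟩ := h1
    refine Or.inr ⟨_, _, crossing_row_col hi hj' h, ?_, ?_⟩ <;> simp [minusRoot] <;> omega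
  by_cases h2 : b = true ∧ c = false ∧ j + 1 < i
  · obtain ⟨rfl, rfl, h⟩ := h2
    refine Or.inr ⟨_, _, (crossing_row_col hj hi' h).symm, ?_, ?_⟩ <;> simp [minusRoot] <;> omega
  left
  rintro ⟨r, s⟩ hr ⟨k, hk, h⟩ ⟨l, hl, h'⟩
  cases b <;> cases c <;>
    simp only [plusRoot, minusRoot, IsPos, if_true, Bool.false_eq_true, if_false, false_and,
      true_and, Bool.true_eq_false, not_false_eq_true, Prod.mk.injEq] at * <;> omega

lemma aSt_eq_and_bStar_eq {R : Bool → KPf → KPf → Prop}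
    (h : ∀ b c, Keeps n (n + 1) (R b) (plusRoot n j c) (minusRoot n j c)) (b : Bool) {x y : KPf}
    (hx : IsKP n x) (hxy : R b x y) : aSt n j y = aSt n j x ∧ bStar n j y = bStar n j x := by
  simp only [aSt, bStar, Wword_eq, Wstar_eq]
  exact ⟨(h b true).plusCt_eq n.succ_pos hx hxy, (h b false).minusCt_eq n.succ_pos hx hxy⟩

lemma respects_bStar_lt_aSt {R : Bool → KPf → KPf → Prop}
    (h : ∀ b c, Keeps n (n + 1) (R b) (plusRoot n j c) (minusRoot n j c)) (b : Bool) :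
    Respects n (R b) (fun x => bStar n j x < aSt n j x) := fun x y hx hxy => by
  obtain ⟨h1, h2⟩ := aSt_eq_and_bStar_eq h b hx hxy
  simp only [h1, h2]

lemma respects_bStar_le_aSt {R : Bool → KPf → KPf → Prop}
    (h : ∀ b c, Keeps n (n + 1) (R b) (plusRoot n j c) (minusRoot n j c)) (b : Bool) :
    Respects n (R b) (fun x => bStar n j x ≤ aSt n j x) := fun x y hx hxy => by
  obtain ⟨h1, h2⟩ := aSt_eq_and_bStar_eq h b hx hxy
  simp only [h1, h2]

lemma eop_isKP (hi : 1 ≤ i) (hi' : i < n) {x y : KPf} (hx : IsKP n x)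
    (h : eop n i x = some y) : IsKP n y := by
  rcases (eop_eq_some n i x y).1 h with ⟨-, h⟩ | ⟨-, h⟩
  · exact (isLocalOp_eRelOf hi hi' true).isKP hx h
  · exact (isLocalOp_eRelOf hi hi' false).isKP hx h

variable (hi : 1 ≤ i) (hi' : i < n) (hj : 1 ≤ j) (hj' : j < n)
  (hij : i + 1 < j ∨ j + 1 < i)

include hi hi' hj hj' hij

lemma keeps_fRelOf (b c : Bool) :
    Keeps n (n + 1) (fRelOf n i b) (plusRoot n j c) (minusRoot n j c) := by
  rcases disj_or_crossing hi hi' hj hj' hij b c with h | ⟨q, p, h, -⟩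
  · exact h.keeps (isLocalOp_fRelOf hi hi' b)
  · exact h.keeps_fRel

lemma keeps_eRelOf (b c : Bool) :
    Keeps n (n + 1) (eRelOf n i b) (plusRoot n j c) (minusRoot n j c) := by
  rcases disj_or_crossing hi hi' hj hj' hij b c with h | ⟨q, p, h, -⟩
  · exact h.keeps (isLocalOp_eRelOf hi hi' b)
  · exact h.keeps_eRel

lemma commuting_fRelOf_fRelOf (b c : Bool) : Commuting n (fRelOf n i b) (fRelOf n j c) := by
  rcases disj_or_crossing hi hi' hj hj' hij b c with h | ⟨q, p, h, -⟩
  · exact h.commuting (isLocalOp_fRelOf hi hi' b) (isLocalOp_fRelOf hj hj' c)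
  · exact h.commuting_fRel_fRel

lemma commuting_fRelOf_eRelOf (b c : Bool) : Commuting n (fRelOf n i b) (eRelOf n j c) := by
  rcases disj_or_crossing hi hi' hj hj' hij b c with h | ⟨q, p, h, h1, h2⟩
  · exact h.commuting (isLocalOp_fRelOf hi hi' b) (isLocalOp_eRelOf hj hj' c)
  · exact h.commuting_fRel_eRel h1 h2

lemma commuting_fop_fop :
    Commuting n (fun x y => fop n i x = some y) (fun x y => fop n j x = some y) := by
  have h := respects_bStar_lt_aSt (keeps_fRelOf hi hi' hj hj' hij)
  have h' := respects_bStar_lt_aSt (keeps_fRelOf hj hj' hi hi' hij.symm)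
  have hc := commuting_fRelOf_fRelOf hi hi' hj hj' hij
  simp only [fop_eq_some]
  exact .branch_left
    ((hc true true).branch_right (hc true false) (h true))
    ((hc false true).branch_right (hc false false) (h false))
    ((h' true).branch (h' false))

lemma commuting_fop_eop :
    Commuting n (fun x y => fop n i x = some y) (fun x y => eop n j x = some y) := by
  have h := respects_bStar_le_aSt (keeps_fRelOf hi hi' hj hj' hij)
  have h' := respects_bStar_lt_aSt (keeps_eRelOf hj hj' hi hi' hij.symm)
  have hc := commuting_fRelOf_eRelOf hi hi' hj hj' hij
  simp only [fop_eq_some, eop_eq_some]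
  exact .branch_left
    ((hc true true).branch_right (hc true false) (h true))
    ((hc false true).branch_right (hc false false) (h false))
    ((h' true).branch (h' false))

lemma iterO_eop_eq_none_iff (k : ℕ) {x y : KPf} (hx : IsKP n x) (hxy : fop n i x = some y) :
    iterO (eop n j) k y = none ↔ iterO (eop n j) k x = none := by
  induction k generalizing x y with
  | zero => simp [iterO]
  | succ k ih =>
    obtain ⟨h1, h2⟩ := commuting_fop_eop hi hi' hj hj' hij x y hx hxy
    rcases hz : eop n j x with _ | z
    · rcases hw : eop n j y with _ | w
      · simp [iterO, hz, hw]
      · obtain ⟨z, hz', -⟩ := h1 w hw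
        simp [hz] at hz'
    · obtain ⟨w, hw, hzw⟩ := h2 z hz
      simpa [iterO, hz, hw] using ih (eop_isKP hj hj' hx hz) hzw

lemma epsS_eq_of_fop_eq_some {x y : KPf} (hx : IsKP n x) (hxy : fop n i x = some y) :
    epsS n j y = epsS n j x := by
  simp only [epsS, ne_eq, iterO_eop_eq_none_iff hi hi' hj hj' hij _ hx hxy]

end Orthogonal

end KFC

open KFC in
/-- Stembridge axiom S2' (orthogonal case) for the modified operators:
if `|i−j| > 1` and `f_i(x) ≠ 0 ≠ f_j(x)`, then `f_i(f_j(x)) = f_j(f_i(x)) ≠ 0`,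
`ε_i(f_j(x)) = ε_i(x)` and `ε_j(f_i(x)) = ε_j(x)`. -/
theorem stmt13 (n : ℕ) (hn : 2 ≤ n) (i j : ℕ)
    (hi1 : 1 ≤ i) (hi2 : i ≤ n - 1) (hj1 : 1 ≤ j) (hj2 : j ≤ n - 1) (hij : i + 1 < j ∨ j + 1 < i)
    (x : KPf) (hx : IsKP n x) (hfi : fop n i x ≠ none) (hfj : fop n j x ≠ none) :
    (fop n j x).bind (fop n i) = (fop n i x).bind (fop n j) ∧
    (fop n j x).bind (fop n i) ≠ none ∧
    epsO n i (fop n j x) = epsS n i x ∧ epsO n j (fop n i x) = epsS n j x := by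
  have hi' : i < n := by omega
  have hj' : j < n := by omega
  obtain ⟨y, hy⟩ := Option.ne_none_iff_exists'.1 hfj
  obtain ⟨z, hz⟩ := Option.ne_none_iff_exists'.1 hfi
  obtain ⟨w, hw, hw'⟩ := (commuting_fop_fop hj1 hj' hi1 hi' hij.symm x y hx hy).2 z hz
  simp only [hy, hz, Option.bind_some, hw, hw', epsO, Option.elim_some]
  exact ⟨trivial, Option.some_ne_none w, epsS_eq_of_fop_eq_some hj1 hj' hi1 hi' hij.symm hx hy,
    epsS_eq_of_fop_eq_some hi1 hi' hj1 hj' hij hx hz⟩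
end

section
/- Let i, j with |i−j| = 1 and let x be a Kostant partition with e_i(x) ≠ 0. Then ε̂_j(e_i(x)) equals either ε̂_j(x) or ε̂_j(x) + 1 (Stembridge axiom S1 for the modified operators in the adjacent case, with ε_j replaced by ε̂_j). -/
open scoped BigOperators

namespace KFC

/-- Composition of reduced signed words `+^a −^b`, recorded as pairs `(a, b)`. -/
def sigMul (p q : ℕ × ℕ) : ℕ × ℕ := (p.1 + (q.1 - p.2), q.2 + (p.2 - q.1))

lemma sigMul_assoc (p q r : ℕ × ℕ) : sigMul (sigMul p q) r = sigMul p (sigMul q r) := by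
  simp only [sigMul, Prod.mk.injEq]; omega

/-- The reduced signature of a word made of the blocks `+^(X h) −^(Y h)`, `h` running over `L`. -/
def sig (X Y : ℕ → ℕ) (L : List ℕ) : ℕ × ℕ :=
  L.foldr (fun h p => sigMul (X h, Y h) p) (0, 0)

@[simp] lemma sig_nil (X Y : ℕ → ℕ) : sig X Y [] = (0, 0) := rfl

@[simp] lemma sig_cons (X Y : ℕ → ℕ) (h : ℕ) (L : List ℕ) :
    sig X Y (h :: L) = sigMul (X h, Y h) (sig X Y L) := rfl

lemma sig_append (X Y : ℕ → ℕ) (L M : List ℕ) :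
    sig X Y (L ++ M) = sigMul (sig X Y L) (sig X Y M) := by
  induction L with
  | nil => simp [sigMul]
  | cons h L ih => rw [List.cons_append, sig_cons, sig_cons, ih, sigMul_assoc]

lemma sig_congr {X Y X' Y' : ℕ → ℕ} {L : List ℕ} (h : ∀ k ∈ L, X' k = X k ∧ Y' k = Y k) :
    sig X' Y' L = sig X Y L := by
  induction L with
  | nil => rfl
  | cons k L ih =>
    rw [sig_cons, sig_cons, ih fun k hk => h k (List.mem_cons_of_mem _ hk),
      (h k List.mem_cons_self).1, (h k List.mem_cons_self).2]

/-- The block `+^(X h) −^(Y h)` with the roots lying under it. -/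
def block (X Y : ℕ → ℕ) (R S : ℕ → Root) (h : ℕ) : List Entry :=
  List.replicate (X h) (true, R h) ++ List.replicate (Y h) (false, S h)

lemma foldl_redStep_replicate_true (x : ℕ) (r : Root) (p q : List Entry)
    (hp : ∀ e ∈ p, e.1 = true) (hq : ∀ e ∈ q, e.1 = false) :
    (List.replicate x ((true, r) : Entry)).foldl redStep (p ++ q) =
      (p ++ List.replicate (x - q.length) (true, r)) ++ q.take (q.length - x) := by
  induction x generalizing p q with
  | zero => simp
  | succ x ih =>
    rw [List.replicate_succ, List.foldl_cons]
    rcases List.eq_nil_or_concat q with rfl | ⟨q', e, rfl⟩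
    · have hstep : redStep (p ++ []) (true, r) = (p ++ [(true, r)]) ++ [] := by
        rcases List.eq_nil_or_concat p with rfl | ⟨p', e', rfl⟩
        · simp [redStep]
        · have := hp e' (by simp)
          obtain ⟨s, t⟩ := e'
          simp only at this
          subst this
          simp [redStep]
      rw [hstep, ih _ _ (by simpa [or_imp, forall_and] using hp) (by simp)]
      simp [List.replicate_succ]
    · have he := hq e (by simp)
      obtain ⟨s, t⟩ := e
      simp only at he
      subst he
      have hstep : redStep (p ++ (q' ++ [(false, t)])) (true, r) = p ++ q' := by
        rw [← List.append_assoc]; simp [redStep]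
      rw [List.concat_eq_append] at hq ⊢
      rw [hstep, ih p q' hp fun e he => hq e (by simp [he])]
      simp only [List.length_append, List.length_singleton, Nat.add_sub_add_right]
      rw [List.take_append_of_le_length (by omega)]

lemma foldl_redStep_replicate_false (y : ℕ) (r : Root) (s : List Entry) :
    (List.replicate y ((false, r) : Entry)).foldl redStep s =
      s ++ List.replicate y (false, r) := by
  induction y generalizing s with
  | zero => simp
  | succ y ih =>
    rw [List.replicate_succ, List.foldl_cons, ih]
    simp [redStep]

/-- The reduced word of a concatenation of blocks has the expected signature, and the leftmost
surviving `−` comes from a block whose `+`s absorb everything before it and whose `−`s are not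
exhausted by what follows. -/
lemma reduceW_flatMap_block (X Y : ℕ → ℕ) (R S : ℕ → Root) (L : List ℕ) :
    ∃ p q : List Entry, reduceW (L.flatMap (block X Y R S)) = p ++ q ∧
      (∀ e ∈ p, e.1 = true) ∧ (∀ e ∈ q, e.1 = false) ∧
      p.length = (sig X Y L).1 ∧ q.length = (sig X Y L).2 ∧
      ∀ e, q.head? = some e → ∃ L₁ h L₂, L = L₁ ++ h :: L₂ ∧ e.2 = S h ∧
        (sig X Y L₁).2 ≤ X h ∧ (sig X Y L₂).1 < Y h := by
  induction L using List.reverseRecOn with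
  | nil => exact ⟨[], [], by simp [reduceW]⟩
  | append_singleton L k ih =>
    obtain ⟨p, q, hw, hp, hq, hpl, hql, hh⟩ := ih
    have hw' : reduceW ((L ++ [k]).flatMap (block X Y R S)) =
        (p ++ List.replicate (X k - q.length) (true, R k)) ++
          (q.take (q.length - X k) ++ List.replicate (Y k) (false, S k)) := by
      rw [reduceW] at hw
      rw [reduceW, List.flatMap_append, List.foldl_append, hw, List.flatMap_singleton, block,
        List.foldl_append, foldl_redStep_replicate_true _ _ _ _ hp hq,
        foldl_redStep_replicate_false, List.append_assoc]
    refine ⟨_, _, hw', ?_, ?_, ?_, ?_, ?_⟩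
    · intro e he
      rcases List.mem_append.1 he with he | he
      · exact hp e he
      · rw [(List.mem_replicate.1 he).2]
    · intro e he
      rcases List.mem_append.1 he with he | he
      · exact hq e (List.mem_of_mem_take he)
      · rw [(List.mem_replicate.1 he).2]
    · simp [sig_append, sigMul, hpl, hql]
    · simp [sig_append, sigMul, hql]; omega
    · intro e he
      by_cases hx : X k < q.length
      · have : q.head? = some e := by
          cases q with
          | nil => simp at hx
          | cons a q =>
            obtain ⟨t, ht⟩ : ∃ t, (a :: q).length - X k = t + 1 :=
              ⟨(a :: q).length - X k - 1, by omega⟩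
            rw [ht] at he
            simpa using he
        obtain ⟨L₁, h, L₂, rfl, h1, h2, h3⟩ := hh e this
        refine ⟨L₁, h, L₂ ++ [k], by simp, h1, h2, ?_⟩
        simp only [sig_append, sigMul, sig_cons, sig_nil] at hql ⊢
        omega
      · have h0 : q.length - X k = 0 := by omega
        rw [h0, List.take_zero, List.nil_append] at he
        have hmem := List.mem_replicate.1 (List.mem_of_mem_head? he)
        refine ⟨L, k, [], rfl, by rw [hmem.2], by omega, ?_⟩
        simpa using Nat.pos_of_ne_zero hmem.1

lemma filter_plus_append {p q : List Entry} (hp : ∀ e ∈ p, e.1 = true)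
    (hq : ∀ e ∈ q, e.1 = false) : (p ++ q).filter (fun e => e.1) = p := by
  rw [List.filter_append, List.filter_eq_self.2 hp,
    List.filter_eq_nil_iff.2 fun e he => by simp [hq e he], List.append_nil]

lemma filter_minus_append {p q : List Entry} (hp : ∀ e ∈ p, e.1 = true)
    (hq : ∀ e ∈ q, e.1 = false) : (p ++ q).filter (fun e => !e.1) = q := by
  rw [List.filter_append, List.filter_eq_nil_iff (l := p) |>.2 fun e he => by simp [hp e he],
    List.filter_eq_self (l := q) |>.2 fun e he => by simp [hq e he], List.nil_append]

lemma plusCt_reduceW_flatMap (X Y : ℕ → ℕ) (R S : ℕ → Root) (L : List ℕ) :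
    plusCt (reduceW (L.flatMap (block X Y R S))) = (sig X Y L).1 := by
  obtain ⟨p, q, hw, hp, hq, hpl, -⟩ := reduceW_flatMap_block X Y R S L
  rw [plusCt, hw, filter_plus_append hp hq, hpl]

lemma minusCt_reduceW_flatMap (X Y : ℕ → ℕ) (R S : ℕ → Root) (L : List ℕ) :
    minusCt (reduceW (L.flatMap (block X Y R S))) = (sig X Y L).2 := by
  obtain ⟨p, q, hw, hp, hq, -, hql, -⟩ := reduceW_flatMap_block X Y R S L
  rw [minusCt, hw, filter_minus_append hp hq, hql]

lemma exists_of_headMinus_flatMap {X Y : ℕ → ℕ} {R S : ℕ → Root} {L : List ℕ} {r : Root}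
    (hr : headMinus (L.flatMap (block X Y R S)) = some r) :
    ∃ L₁ h L₂, L = L₁ ++ h :: L₂ ∧ r = S h ∧
      (sig X Y L₁).2 ≤ X h ∧ (sig X Y L₂).1 < Y h := by
  obtain ⟨p, q, hw, hp, hq, -, -, hh⟩ := reduceW_flatMap_block X Y R S L
  rw [headMinus, hw, filter_minus_append hp hq, Option.map_eq_some_iff] at hr
  obtain ⟨e, he, rfl⟩ := hr
  exact hh e he

lemma headMinus_ne_none {w : List Entry} (h : 0 < minusCt (reduceW w)) : headMinus w ≠ none := by
  rw [headMinus, Ne, Option.map_eq_none_iff, List.head?_eq_none_iff]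
  exact List.ne_nil_of_length_pos h

/-- If a word starts with the block `−^m`, its leftmost surviving `−` either lies in that first
block, or in a later block whose first `−` may be turned into a `+`. -/
lemma headMinus_cases {X Y : ℕ → ℕ} {R S : ℕ → Root} {k : ℕ} {L : List ℕ} (hL : L.Nodup)
    (hk : X k = 0) {r : Root}
    (hr : headMinus ((k :: L).flatMap (block X Y R S)) = some r) :
    (r = S k ∧ (sig X Y L).1 < Y k) ∨
    ∃ h ∈ L, r = S h ∧ 0 < Y h ∧ Y k ≤ (sig X Y L).1 ∧ 0 < (sig X Y L).2 ∧
      (L.head? = some h → Y k ≤ X h) ∧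
      ∀ X' Y' : ℕ → ℕ, (∀ l ∈ L, l ≠ h → X' l = X l ∧ Y' l = Y l) →
        X' h = X h + 1 → Y' h = Y h - 1 →
        sig X' Y' L = ((sig X Y L).1 + 1, (sig X Y L).2 - 1) := by
  obtain ⟨L₁, h, L₂, hdec, rfl, h1, h2⟩ := exists_of_headMinus_flatMap hr
  cases L₁ with
  | nil =>
    obtain ⟨rfl, rfl⟩ := List.cons.inj hdec
    exact Or.inl ⟨rfl, h2⟩
  | cons k' L₁ =>
    rw [List.cons_append, List.cons.injEq] at hdec
    obtain ⟨rfl, rfl⟩ := hdec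
    right
    have hn₁ : h ∉ L₁ := fun hm => (List.disjoint_of_nodup_append hL) hm List.mem_cons_self
    have hn₂ : h ∉ L₂ := (List.nodup_cons.1 (List.nodup_append.1 hL).2.1).1
    simp only [sig_cons, sigMul, hk] at h1
    refine ⟨h, by simp, rfl, by omega, ?_, ?_, ?_, ?_⟩
    · simp only [sig_append, sig_cons, sigMul]; omega
    · simp only [sig_append, sig_cons, sigMul]; omega
    · intro hh
      cases L₁ with
      | nil => simpa using h1
      | cons a L₁ => simp at hh; simp [hh] at hn₁
    · intro X' Y' hne hX hY
      rw [sig_append, sig_append, sig_cons, sig_cons,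
        sig_congr (L := L₁) fun l hl => hne l (by simp [hl]) (by rintro rfl; exact hn₁ hl),
        sig_congr (L := L₂) fun l hl => hne l (by simp [hl]) (by rintro rfl; exact hn₂ hl), hX, hY]
      simp only [sigMul, Prod.mk.injEq]
      omega

/-- Removing a `+` or inserting a `−` changes a signature in one of two ways. -/
def SigRaise (p q : ℕ × ℕ) : Prop := p = (q.1 + 1, q.2) ∨ q = (p.1, p.2 + 1)

lemma sigRaise_sig {X Y X' Y' : ℕ → ℕ} {L : List ℕ} (hL : L.Nodup) {h : ℕ} (hh : h ∈ L)
    (hne : ∀ l ∈ L, l ≠ h → X' l = X l ∧ Y' l = Y l)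
    (hXY : (X' h + 1 = X h ∧ Y' h = Y h) ∨ (X' h = X h ∧ Y' h = Y h + 1)) :
    SigRaise (sig X Y L) (sig X' Y' L) := by
  obtain ⟨L₁, L₂, rfl⟩ := List.append_of_mem hh
  have hn₁ : h ∉ L₁ := fun hm => (List.disjoint_of_nodup_append hL) hm List.mem_cons_self
  have hn₂ : h ∉ L₂ := (List.nodup_cons.1 (List.nodup_append.1 hL).2.1).1
  rw [sig_append, sig_append, sig_cons, sig_cons,
    sig_congr (L := L₁) fun l hl => hne l (by simp [hl]) (by rintro rfl; exact hn₁ hl),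
    sig_congr (L := L₂) fun l hl => hne l (by simp [hl]) (by rintro rfl; exact hn₂ hl)]
  simp only [SigRaise, sigMul, Prod.mk.injEq]
  omega

/-- The first coordinates occurring in `W_i` away from the simple root, in order. -/
def rowKeys (i : ℕ) : List ℕ := (List.range i).reverse

/-- The second coordinates occurring in `W_i*` away from the simple root, in order. -/
def colKeys (n i : ℕ) : List ℕ := List.range' (i + 2) (n - 1 - i)

lemma mem_rowKeys {i h : ℕ} : h ∈ rowKeys i ↔ h < i := by simp [rowKeys]

lemma mem_colKeys {n i b : ℕ} :
    b ∈ colKeys n i ↔ i + 2 ≤ b ∧ b ≤ n := by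
  rw [colKeys, List.mem_range'_1]; omega

lemma nodup_rowKeys (i : ℕ) : (rowKeys i).Nodup := List.nodup_reverse.2 List.nodup_range

lemma nodup_colKeys (n i : ℕ) : (colKeys n i).Nodup := List.nodup_range'

/-- Signature of `W_i` with the simple root removed. -/
def rowSig (i : ℕ) (α : KPf) : ℕ × ℕ := sig (fun h => α (h, i)) (fun h => α (h, i + 1)) (rowKeys i)

/-- Signature of `W_i*` with the simple root removed. -/
def colSig (n i : ℕ) (α : KPf) : ℕ × ℕ :=
  sig (fun b => α (i + 1, b)) (fun b => α (i, b)) (colKeys n i)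

lemma IsKP.eq_zero {n : ℕ} {α : KPf} (hα : IsKP n α) {a b : ℕ} (h : b ≤ a) : α (a, b) = 0 := by
  by_contra h0
  have := (hα _ h0).2.1
  simp only at this
  omega

lemma Wword_eq_s17 {n i : ℕ} (hn : 2 ≤ n) (hi : i ≤ n - 1) {α : KPf} (hα : IsKP n α) :
    Wword n i α = (i :: rowKeys i).flatMap
      (block (fun h => α (h, i)) (fun h => α (h, i + 1)) (fun h => (h, i)) fun h => (h, i + 1)) := by
  have hsplit : (List.range (n + 1)).reverse =
      (List.range' (i + 1) (n - i)).reverse ++ (i :: rowKeys i) := by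
    rw [rowKeys, show i :: (List.range i).reverse = (List.range (i + 1)).reverse by
      rw [List.range_succ]; simp, ← List.reverse_append, List.range_eq_range', List.range_eq_range',
      show n + 1 = (i + 1) + (n - i) by omega, ← List.range'_append_1]
    simp
  rw [Wword, hsplit, List.flatMap_append]
  have h0 : (List.range' (i + 1) (n - i)).reverse.flatMap (fun h =>
      List.replicate (α (h, i)) ((true, (h, i)) : Entry) ++
      List.replicate (α (h, i+1)) ((false, (h, i+1)) : Entry)) = [] := by
    rw [List.flatMap_eq_nil_iff]
    intro h hh
    rw [List.mem_reverse, List.mem_range'_1] at hh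
    rw [hα.eq_zero (by omega : i ≤ h), hα.eq_zero (by omega : i + 1 ≤ h)]
    simp
  rw [h0, List.nil_append]
  rfl

lemma Wstar_eq_s17 {n i : ℕ} (hn : 2 ≤ n) (hi : i ≤ n - 1) {α : KPf} (hα : IsKP n α) :
    Wstar n i α = ((i + 1) :: colKeys n i).flatMap
      (block (fun b => α (i + 1, b)) (fun b => α (i, b)) (fun b => (i + 1, b)) fun b => (i, b)) := by
  have hsplit : List.range (n + 1) = List.range (i + 1) ++ ((i + 1) :: colKeys n i) := by
    rw [colKeys, show (i + 1) :: List.range' (i + 2) (n - 1 - i) = List.range' (i + 1) (n - i) by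
      rw [show n - i = (n - 1 - i) + 1 by omega, List.range'_succ], List.range_eq_range',
      List.range_eq_range', show n + 1 = (i + 1) + (n - i) by omega, ← List.range'_append_1]
    simp
  rw [Wstar, hsplit, List.flatMap_append]
  have h0 : (List.range (i + 1)).flatMap (fun j =>
      List.replicate (α (i+1, j)) ((true, (i+1, j)) : Entry) ++
      List.replicate (α (i, j)) ((false, (i, j)) : Entry)) = [] := by
    rw [List.flatMap_eq_nil_iff]
    intro h hh
    rw [List.mem_range] at hh
    rw [hα.eq_zero (by omega : h ≤ i), hα.eq_zero (by omega : h ≤ i + 1)]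
    simp
  rw [h0, List.nil_append]
  rfl

section Stats

variable {n i : ℕ} {α : KPf}

lemma aSt_eq (hn : 2 ≤ n) (hi : i ≤ n - 1) (hα : IsKP n α) :
    aSt n i α = (rowSig i α).1 - α (i, i + 1) := by
  rw [aSt, Wword_eq_s17 hn hi hα, plusCt_reduceW_flatMap, sig_cons, ← rowSig,
    hα.eq_zero (le_refl i)]
  simp [sigMul]

lemma bSt_eq (hn : 2 ≤ n) (hi : i ≤ n - 1) (hα : IsKP n α) :
    bSt n i α = (rowSig i α).2 + (α (i, i + 1) - (rowSig i α).1) := by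
  rw [bSt, Wword_eq_s17 hn hi hα, minusCt_reduceW_flatMap, sig_cons, ← rowSig,
    hα.eq_zero (le_refl i)]
  simp [sigMul]

lemma bStar_eq (hn : 2 ≤ n) (hi : i ≤ n - 1) (hα : IsKP n α) :
    bStar n i α = (colSig n i α).2 + (α (i, i + 1) - (colSig n i α).1) := by
  rw [bStar, Wstar_eq_s17 hn hi hα, minusCt_reduceW_flatMap, sig_cons, ← colSig,
    hα.eq_zero (le_refl (i + 1))]
  simp [sigMul]

/-- The two possible outcomes of `ẽ_i`: removing the simple root, or moving a root
from column `i+1` to column `i`. -/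
lemma headMinus_Wword (hn : 2 ≤ n) (hi : i ≤ n - 1) (hα : IsKP n α) {r : Root}
    (hr : headMinus (Wword n i α) = some r) :
    (r = (i, i + 1) ∧ (rowSig i α).1 < α (i, i + 1)) ∨
    ∃ h < i, r = (h, i + 1) ∧ 0 < α (h, i + 1) ∧ α (i, i + 1) ≤ (rowSig i α).1 ∧
      0 < (rowSig i α).2 ∧
      rowSig i (KPmove α r (h, i)) = ((rowSig i α).1 + 1, (rowSig i α).2 - 1) := by
  rw [Wword_eq_s17 hn hi hα] at hr
  rcases headMinus_cases (nodup_rowKeys i) (hα.eq_zero (le_refl i)) hr with h | h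
  · exact Or.inl h
  · obtain ⟨h, hh, rfl, h1, h2, h3, -, h5⟩ := h
    refine Or.inr ⟨h, mem_rowKeys.1 hh, rfl, h1, h2, h3,
      h5 _ _ (fun l _ hl => ?_) ?_ ?_⟩ <;>
     simp [KPmove, KPadd, KPsub, *]

/-- The two possible outcomes of `ẽ_i*`: removing the simple root, or moving a root
from row `i` to row `i+1`. -/
lemma headMinus_Wstar (hn : 2 ≤ n) (hi : i ≤ n - 1) (hα : IsKP n α) {r : Root}
    (hr : headMinus (Wstar n i α) = some r) :
    (r = (i, i + 1) ∧ (colSig n i α).1 < α (i, i + 1)) ∨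
    ∃ b, i + 2 ≤ b ∧ b ≤ n ∧ r = (i, b) ∧ 0 < α (i, b) ∧ α (i, i + 1) ≤ (colSig n i α).1 ∧
      0 < (colSig n i α).2 ∧ (b = i + 2 → α (i, i + 1) ≤ α (i + 1, b)) ∧
      colSig n i (KPmove α r (i + 1, b)) = ((colSig n i α).1 + 1, (colSig n i α).2 - 1) := by
  rw [Wstar_eq_s17 hn hi hα] at hr
  rcases headMinus_cases (nodup_colKeys n i) (hα.eq_zero (le_refl (i + 1))) hr with h | h
  · exact Or.inl h
  · obtain ⟨b, hb, rfl, h1, h2, h3, h4, h5⟩ := h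
    obtain ⟨hb1, hb2⟩ := mem_colKeys.1 hb
    refine Or.inr ⟨b, hb1, hb2, rfl, h1, h2, h3, ?_, ?_⟩
    · rintro rfl
      refine h4 ?_
      rw [colKeys, show n - 1 - i = (n - 2 - i) + 1 by omega, List.range'_succ, List.head?_cons]
    · refine h5 _ _ (fun l _ hl => ?_) ?_ ?_ <;> simp [KPmove, KPadd, KPsub, *]

/-- Closed form for `ε̂_i`. -/
def epsHatFormula (m : ℕ) (p q : ℕ × ℕ) : ℕ :=
  p.2 + (m + max q.2 ((q.2 + p.1 - q.1 + 1) / 2) - p.1)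

/-- The closed form evaluated at a Kostant partition. -/
def epsHatVal (n i : ℕ) (α : KPf) : ℕ :=
  epsHatFormula (α (i, i + 1)) (rowSig i α) (colSig n i α)

lemma IsKP.sub (hα : IsKP n α) (r : Root) : IsKP n (KPsub α r) := by
  intro p hp
  refine hα p fun h0 => hp ?_
  simp [KPsub, h0]

lemma IsKP.move (hα : IsKP n α) (r : Root) {s : Root} (hs : IsPos n s) :
    IsKP n (KPmove α r s) := by
  intro p hp
  by_cases h : p = s
  · rwa [h]
  · exact hα.sub r p (by simpa [KPmove, KPadd, h] using hp)

lemma rowSig_congr {β : KPf} (h : ∀ k < i, β (k, i) = α (k, i) ∧ β (k, i + 1) = α (k, i + 1)) :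
    rowSig i β = rowSig i α :=
  sig_congr fun k hk => h k (mem_rowKeys.1 hk)

lemma colSig_congr {β : KPf}
    (h : ∀ b, i + 2 ≤ b → β (i + 1, b) = α (i + 1, b) ∧ β (i, b) = α (i, b)) :
    colSig n i β = colSig n i α :=
  sig_congr fun b hb => h b (mem_colKeys.1 hb).1

lemma KPmove_of_ne {a b c d e f : ℕ} (hr : a ≠ c ∨ b ≠ d) (hs : a ≠ e ∨ b ≠ f) :
    KPmove α (c, d) (e, f) (a, b) = α (a, b) := by
  simp only [KPmove, KPadd, KPsub, Prod.mk.injEq]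
  rw [if_neg (by omega), if_neg (by omega)]

lemma KPsub_of_ne {a b c d : ℕ} (hr : a ≠ c ∨ b ≠ d) : KPsub α (c, d) (a, b) = α (a, b) := by
  simp only [KPsub, Prod.mk.injEq]
  rw [if_neg (by omega)]

lemma ehat_step_simple :
    rowSig i (KPsub α (i, i + 1)) = rowSig i α ∧
    colSig n i (KPsub α (i, i + 1)) = colSig n i α ∧
    KPsub α (i, i + 1) (i, i + 1) = α (i, i + 1) - 1 := by
  refine ⟨rowSig_congr fun k hk => ⟨?_, ?_⟩, colSig_congr fun b hb => ⟨?_, ?_⟩, ?_⟩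
  · exact KPsub_of_ne (by omega)
  · exact KPsub_of_ne (by omega)
  · exact KPsub_of_ne (by omega)
  · exact KPsub_of_ne (by omega)
  · simp [KPsub]

lemma ehat_eq_some (hn : 2 ≤ n) (hi : i ≤ n - 1) (hα : IsKP n α) {β : KPf}
    (h : ehat n i α = some β) : IsKP n β ∧ epsHatVal n i β + 1 = epsHatVal n i α := by
  obtain ⟨hr, hc, hm⟩ := ehat_step_simple (n := n) (i := i) (α := α)
  rw [ehat, aSt_eq hn hi hα, bSt_eq hn hi hα, bStar_eq hn hi hα] at h
  split_ifs at h with h1 h2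
  · rw [etilde] at h
    cases hh : headMinus (Wword n i α) with
    | none => simp [hh] at h
    | some r =>
      rw [hh] at h
      dsimp only at h
      rcases headMinus_Wword hn hi hα hh with ⟨rfl, h3⟩ | ⟨k, hk, rfl, h3, h4, h5, h6⟩
      · rw [if_pos rfl, Option.some.injEq] at h
        subst h
        refine ⟨hα.sub _, ?_⟩
        rw [epsHatVal, epsHatVal, hr, hc, hm]
        simp only [epsHatFormula]
        omega
      · rw [if_neg (by simp only [Prod.mk.injEq]; omega), Option.some.injEq] at h
        subst h
        refine ⟨hα.move _ ⟨(hα _ h3.ne').1, hk, by simp only; omega⟩, ?_⟩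
        rw [epsHatVal, epsHatVal, h6, KPmove_of_ne (by omega) (by omega),
          colSig_congr (α := α) fun b hb =>
            ⟨KPmove_of_ne (by omega) (by omega),
              KPmove_of_ne (by omega) (by omega)⟩]
        simp only [epsHatFormula]
        omega
  · rw [etildeS] at h
    cases hh : headMinus (Wstar n i α) with
    | none => simp [hh] at h
    | some r =>
      rw [hh] at h
      dsimp only at h
      rcases headMinus_Wstar hn hi hα hh with ⟨rfl, h3⟩ | ⟨b, hb, hbn, rfl, h3, h4, h5, -, h6⟩
      · rw [if_pos rfl, Option.some.injEq] at h
        subst h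
        refine ⟨hα.sub _, ?_⟩
        rw [epsHatVal, epsHatVal, hr, hc, hm]
        simp only [epsHatFormula]
        omega
      · rw [if_neg (by simp only [Prod.mk.injEq]; omega), Option.some.injEq] at h
        subst h
        refine ⟨hα.move _ ⟨by simp, by simp only; omega, hbn⟩, ?_⟩
        rw [epsHatVal, epsHatVal, h6, KPmove_of_ne (by omega) (by omega),
          rowSig_congr (α := α) fun k hk =>
            ⟨KPmove_of_ne (by omega) (by omega),
              KPmove_of_ne (by omega) (by omega)⟩]
        simp only [epsHatFormula]
        omega

lemma ehat_eq_none (hn : 2 ≤ n) (hi : i ≤ n - 1) (hα : IsKP n α)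
    (h : ehat n i α = none) : epsHatVal n i α = 0 := by
  have hb := bSt_eq hn hi hα
  rw [ehat] at h
  split_ifs at h with h1 h2
  · exfalso
    rw [etilde] at h
    obtain ⟨r, hr⟩ := Option.ne_none_iff_exists'.1 (headMinus_ne_none (w := Wword n i α) h2)
    rw [hr] at h
    simp only at h
    split_ifs at h
  · rw [aSt_eq hn hi hα, bStar_eq hn hi hα] at h1
    simp only [epsHatVal, epsHatFormula]
    omega
  · exfalso
    rw [etildeS] at h
    obtain ⟨r, hr⟩ := Option.ne_none_iff_exists'.1
      (headMinus_ne_none (w := Wstar n i α) (by rw [← bStar]; omega))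
    rw [hr] at h
    simp only at h
    split_ifs at h

lemma iterO_ehat_ne_none (hn : 2 ≤ n) (hi : i ≤ n - 1) (k : ℕ) (hα : IsKP n α) :
    iterO (ehat n i) k α ≠ none ↔ k ≤ epsHatVal n i α := by
  induction k generalizing α with
  | zero => simp [iterO]
  | succ k ih =>
    rw [iterO]
    cases h : ehat n i α with
    | none => simp [ehat_eq_none hn hi hα h]
    | some β =>
      obtain ⟨hβ, hv⟩ := ehat_eq_some hn hi hα h
      rw [Option.bind_some, ih hβ]
      omega

lemma epsHatS_eq (hn : 2 ≤ n) (hi : i ≤ n - 1) (hα : IsKP n α) :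
    epsHatS n i α = epsHatVal n i α := by
  have : {k | iterO (ehat n i) k α ≠ none} = Set.Iic (epsHatVal n i α) :=
    Set.ext fun k => iterO_ehat_ne_none hn hi k hα
  rw [epsHatS, this, csSup_Iic]

/-- A nonzero `e_i` moves a single root, either between columns or between rows. -/
lemma eop_eq_some_s17 (hn : 2 ≤ n) (hi : i ≤ n - 1) (hα : IsKP n α) {β : KPf}
    (h : eop n i α = some β) :
    (∃ k < i, 0 < α (k, i + 1) ∧
      β = KPmove α (k, i + 1) (k, i)) ∨
    (∃ b, i + 2 ≤ b ∧ b ≤ n ∧ 0 < α (i, b) ∧ (b = i + 2 → α (i, i + 1) ≤ α (i + 1, b)) ∧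
      β = KPmove α (i, b) (i + 1, b)) := by
  rw [eop] at h
  split_ifs at h with h1 h2 h2
  · rw [etilde] at h
    cases hh : headMinus (Wword n i α) with
    | none => simp [hh] at h
    | some r =>
      rw [hh] at h
      dsimp only at h
      rcases headMinus_Wword hn hi hα hh with ⟨rfl, h3⟩ | ⟨k, hk, rfl, h3, -⟩
      · exact absurd hh h2.2
      · rw [if_neg (by simp only [Prod.mk.injEq]; omega), Option.some.injEq] at h
        exact Or.inl ⟨k, hk, h3, h.symm⟩
  · rw [etildeS] at h
    cases hh : headMinus (Wstar n i α) with
    | none => simp [hh] at h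
    | some r =>
      rw [hh] at h
      dsimp only at h
      rcases headMinus_Wstar hn hi hα hh with ⟨rfl, h3⟩ | ⟨b, hb, hbn, rfl, h3, -, -, h4, -⟩
      · exact absurd hh h2
      · rw [if_neg (by simp only [Prod.mk.injEq]; omega), Option.some.injEq] at h
        exact Or.inr ⟨b, hb, hbn, h3, h4, h.symm⟩

lemma rowSig_raise {β : KPf} {h : ℕ} (hh : h < i)
    (hne : ∀ l < i, l ≠ h → β (l, i) = α (l, i) ∧ β (l, i + 1) = α (l, i + 1))
    (hXY : (β (h, i) + 1 = α (h, i) ∧ β (h, i + 1) = α (h, i + 1)) ∨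
      (β (h, i) = α (h, i) ∧ β (h, i + 1) = α (h, i + 1) + 1)) :
    SigRaise (rowSig i α) (rowSig i β) :=
  sigRaise_sig (nodup_rowKeys i) (mem_rowKeys.2 hh)
    (fun l hl => hne l (mem_rowKeys.1 hl)) hXY

lemma colSig_raise {β : KPf} {b : ℕ} (hb : i + 2 ≤ b) (hbn : b ≤ n)
    (hne : ∀ l, i + 2 ≤ l → l ≠ b → β (i + 1, l) = α (i + 1, l) ∧ β (i, l) = α (i, l))
    (hXY : (β (i + 1, b) + 1 = α (i + 1, b) ∧ β (i, b) = α (i, b)) ∨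
      (β (i + 1, b) = α (i + 1, b) ∧ β (i, b) = α (i, b) + 1)) :
    SigRaise (colSig n i α) (colSig n i β) :=
  sigRaise_sig (nodup_colKeys n i) (mem_colKeys.2 ⟨hb, hbn⟩)
    (fun l hl => hne l (mem_colKeys.1 hl).1) hXY

lemma epsHatFormula_raise_row {m : ℕ} {p p' q : ℕ × ℕ} (h : SigRaise p p') :
    epsHatFormula m p' q = epsHatFormula m p q ∨
    epsHatFormula m p' q = epsHatFormula m p q + 1 := by
  rcases h with h | h <;> subst h <;> simp only [epsHatFormula] <;> omega

lemma epsHatFormula_raise_col {m : ℕ} {p q q' : ℕ × ℕ} (h : SigRaise q q') :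
    epsHatFormula m p q' = epsHatFormula m p q ∨
    epsHatFormula m p q' = epsHatFormula m p q + 1 := by
  rcases h with h | h <;> subst h <;> simp only [epsHatFormula] <;> omega

end Stats

lemma epsHatVal_column_move {n i j : ℕ} {x : KPf} (hi : i ≤ n - 1)
    (hij : j = i + 1 ∨ i = j + 1) {k : ℕ} (hk : k < i) (hpos : 0 < x (k, i + 1)) :
    epsHatVal n j (KPmove x (k, i + 1) (k, i)) = epsHatVal n j x ∨
    epsHatVal n j (KPmove x (k, i + 1) (k, i)) = epsHatVal n j x + 1 := by
  rcases hij with rfl | rfl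
  · rw [epsHatVal, epsHatVal, KPmove_of_ne (by omega) (by omega),
      colSig_congr (α := x) fun b hb =>
        ⟨KPmove_of_ne (by omega) (by omega),
          KPmove_of_ne (by omega) (by omega)⟩]
    refine epsHatFormula_raise_row (rowSig_raise (h := k) (by omega) (fun l _ hl => ?_) ?_)
    · simp [KPmove, KPadd, KPsub, hl]
    · left; simp [KPmove, KPadd, KPsub]; omega
  · by_cases hkj : k = j
    · subst hkj
      rw [epsHatVal, epsHatVal, rowSig_congr (α := x) fun l hl =>
        ⟨KPmove_of_ne (by omega) (by omega), KPmove_of_ne (by omega) (by omega)⟩]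
      have hkeys : colKeys n k = (k + 2) :: List.range' (k + 3) (n - 2 - k) := by
        rw [colKeys, show n - 1 - k = (n - 2 - k) + 1 by omega, List.range'_succ]
      have htail : ∀ l ∈ List.range' (k + 3) (n - 2 - k),
          KPmove x (k, k + 1 + 1) (k, k + 1) (k + 1, l) = x (k + 1, l) ∧
          KPmove x (k, k + 1 + 1) (k, k + 1) (k, l) = x (k, l) := by
        intro l hl
        rw [List.mem_range'_1] at hl
        exact ⟨KPmove_of_ne (by omega) (by omega),
          KPmove_of_ne (by omega) (by omega)⟩
      rw [colSig, colSig, hkeys, sig_cons, sig_cons, sig_congr htail]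
      simp [KPmove, KPadd, KPsub, epsHatFormula, sigMul] at hpos ⊢
      omega
    · rw [epsHatVal, epsHatVal, KPmove_of_ne (by omega) (by omega),
        colSig_congr (α := x) fun b hb =>
          ⟨KPmove_of_ne (by omega) (by omega),
            KPmove_of_ne (by omega) (by omega)⟩]
      refine epsHatFormula_raise_row (rowSig_raise (h := k) (by omega) (fun l _ hl => ?_) ?_)
      · simp [KPmove, KPadd, KPsub, hl]
      · right; simp [KPmove, KPadd, KPsub]; omega

lemma epsHatVal_row_move {n i j : ℕ} {x : KPf} (hj : j ≤ n - 1)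
    (hij : j = i + 1 ∨ i = j + 1) {b : ℕ} (hb : i + 2 ≤ b) (hbn : b ≤ n) (hpos : 0 < x (i, b))
    (hle : b = i + 2 → x (i, i + 1) ≤ x (i + 1, b)) :
    epsHatVal n j (KPmove x (i, b) (i + 1, b)) = epsHatVal n j x ∨
    epsHatVal n j (KPmove x (i, b) (i + 1, b)) = epsHatVal n j x + 1 := by
  rcases hij with rfl | rfl
  · by_cases hbi : b = i + 2
    · subst hbi
      replace hpos : 0 < x (i, i + 1 + 1) := hpos
      replace hle : x (i, i + 1) ≤ x (i + 1, i + 1 + 1) := hle rfl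
      rw [epsHatVal, epsHatVal, colSig_congr (α := x) fun l hl =>
        ⟨KPmove_of_ne (by omega) (by omega), KPmove_of_ne (by omega) (by omega)⟩]
      have hkeys : rowKeys (i + 1) = i :: (List.range i).reverse := by
        simp [rowKeys, List.range_succ]
      have htail : ∀ l ∈ (List.range i).reverse,
          KPmove x (i, i + 2) (i + 1, i + 2) (l, i + 1) = x (l, i + 1) ∧
          KPmove x (i, i + 2) (i + 1, i + 2) (l, i + 1 + 1) = x (l, i + 1 + 1) := by
        intro l hl
        rw [List.mem_reverse, List.mem_range] at hl
        exact ⟨KPmove_of_ne (by omega) (by omega),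
          KPmove_of_ne (by omega) (by omega)⟩
      rw [rowSig, rowSig, hkeys, sig_cons, sig_cons, sig_congr htail]
      simp [KPmove, KPadd, KPsub, epsHatFormula, sigMul] at hpos hle ⊢
      omega
    · rw [epsHatVal, epsHatVal, KPmove_of_ne (by omega) (by omega),
        rowSig_congr (α := x) fun k hk =>
          ⟨KPmove_of_ne (by omega) (by omega),
            KPmove_of_ne (by omega) (by omega)⟩]
      refine epsHatFormula_raise_col
        (colSig_raise (b := b) (by omega) hbn (fun l _ hl => ?_) ?_)
      · simp [KPmove, KPadd, KPsub, hl]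
      · right; simp [KPmove, KPadd, KPsub]; omega
  · rw [epsHatVal, epsHatVal, KPmove_of_ne (by omega) (by omega),
      rowSig_congr (α := x) fun k hk =>
        ⟨KPmove_of_ne (by omega) (by omega),
          KPmove_of_ne (by omega) (by omega)⟩]
    refine epsHatFormula_raise_col
      (colSig_raise (b := b) (by omega) hbn (fun l _ hl => ?_) ?_)
    · simp [KPmove, KPadd, KPsub, hl]
    · left; simp [KPmove, KPadd, KPsub]; omega

end KFC


open KFC in
/-- Stembridge axiom S1 (adjacent case, with `ε_j` replaced by `ε̂_j`) for the
modified operators: if `|i−j| = 1` and `e_i(x) ≠ 0`, then `ε̂_j(e_i(x))` equals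
`ε̂_j(x)` or `ε̂_j(x) + 1`. -/
theorem stmt17 (n : ℕ) (hn : 2 ≤ n) (i j : ℕ)
    (hi1 : 1 ≤ i) (hi2 : i ≤ n - 1) (hj1 : 1 ≤ j) (hj2 : j ≤ n - 1) (hij : j = i + 1 ∨ i = j + 1)
    (x : KPf) (hx : IsKP n x) (he : eop n i x ≠ none) :
    epsHatO n j (eop n i x) = epsHatS n j x ∨
    epsHatO n j (eop n i x) = epsHatS n j x + 1 := by
  obtain ⟨y, hy⟩ := Option.ne_none_iff_exists'.1 he
  have hx' := epsHatS_eq hn hj2 hx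
  rcases eop_eq_some_s17 hn hi2 hx hy with ⟨k, hk, hpos, rfl⟩ | ⟨b, hb, hbn, hpos, hle, rfl⟩
  · rw [hy, epsHatO, Option.elim_some, hx', epsHatS_eq hn hj2
      (hx.move (s := (k, i)) _ ⟨(hx _ hpos.ne').1, hk, by simp only; omega⟩)]
    exact epsHatVal_column_move hi2 hij hk hpos
  · rw [hy, epsHatO, Option.elim_some, hx', epsHatS_eq hn hj2
      (hx.move (s := (i + 1, b)) _ ⟨by simp, by simp only; omega, hbn⟩)]
    exact epsHatVal_row_move hj2 hij hb hbn hpos hle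
end

section
/- For every Kostant partition α and every 1 ≤ i ≤ n−1: (1) if f_i(α) ≠ 0, then |f_i(α)| = |α| and the evaluation of f_i(α) equals ᾱ + (ε_i − ε_{i+1}); (2) if e_i(α) ≠ 0, then e_i(α) = ê_i(α), |e_i(α)| = |α|, and the evaluation of e_i(α) equals ᾱ − (ε_i − ε_{i+1}); (3) if ê_i(α) ≠ 0, then the evaluation of ê_i(α) equals ᾱ − (ε_i − ε_{i+1}), and either ê_i(α) = e_i(α) with |ê_i(α)| = |α|, or e_i(α) = 0 and ê_i(α) is obtained from α by removing one copy of the simple root (i,i+1), so that |ê_i(α)| = |α| − 1. -/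
open scoped BigOperators

namespace KFC

lemma mem_kbox {n : ℕ} {r : Root} : r ∈ kbox n ↔ r.1 ≤ n ∧ r.2 ≤ n := by
  simp [kbox, Finset.mem_product]

lemma IsKP.mem_kbox {n : ℕ} {α : KPf} (hα : IsKP n α) {r : Root} (hr : α r ≠ 0) :
    r ∈ kbox n := by
  obtain ⟨-, h₂, h₃⟩ := hα r hr
  exact KFC.mem_kbox.2 ⟨by omega, h₃⟩

/-- The vector `ε_a − ε_b` attached to the pair `(a,b)`. -/
def rootVec (r : Root) : ℕ → ℤ := fun k => (if r.1 = k then 1 else 0) - (if r.2 = k then 1 else 0)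

lemma KPadd_KPsub {α : KPf} {r : Root} (hr : α r ≠ 0) : KPadd (KPsub α r) r = α := by
  funext p
  by_cases h : p = r
  · subst h
    simp only [KPadd, KPsub, if_true]
    omega
  · simp [KPadd, KPsub, h]

lemma kpSize_KPadd {n : ℕ} (α : KPf) {r : Root} (hr : r ∈ kbox n) :
    kpSize n (KPadd α r) = kpSize n α + 1 := by
  have h : ∀ p, KPadd α r p = α p + if p = r then 1 else 0 := by
    intro p
    by_cases h : p = r <;> simp [KPadd, h]
  simp [kpSize, h, Finset.sum_add_distrib, hr]

lemma kpEval_KPadd {n : ℕ} (α : KPf) {r : Root} (hr : r ∈ kbox n) (k : ℕ) :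
    kpEval n (KPadd α r) k = kpEval n α k + rootVec r k := by
  have h : ∀ p, (KPadd α r p : ℤ) * rootVec p k =
      (α p : ℤ) * rootVec p k + if p = r then rootVec p k else 0 := by
    intro p
    by_cases h : p = r
    · simp only [KPadd, h, if_true]
      push_cast
      ring
    · simp [KPadd, h]
  change ∑ p ∈ kbox n, (KPadd α r p : ℤ) * rootVec p k =
    ∑ p ∈ kbox n, (α p : ℤ) * rootVec p k + rootVec r k
  simp only [h, Finset.sum_add_distrib, Finset.sum_ite_eq', hr, if_true]

lemma kpSize_KPsub {n : ℕ} {α : KPf} {r : Root} (hr : r ∈ kbox n) (h0 : α r ≠ 0) :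
    kpSize n (KPsub α r) + 1 = kpSize n α := by
  rw [← kpSize_KPadd _ hr, KPadd_KPsub h0]

lemma kpEval_KPsub {n : ℕ} {α : KPf} {r : Root} (hr : r ∈ kbox n) (h0 : α r ≠ 0) (k : ℕ) :
    kpEval n (KPsub α r) k = kpEval n α k - rootVec r k := by
  have h := kpEval_KPadd (KPsub α r) hr k
  rw [KPadd_KPsub h0] at h
  omega

lemma kpSize_KPmove {n : ℕ} {α : KPf} {r r' : Root} (hr : r ∈ kbox n) (hr' : r' ∈ kbox n)
    (h0 : α r ≠ 0) : kpSize n (KPmove α r r') = kpSize n α := by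
  rw [KPmove, kpSize_KPadd _ hr', kpSize_KPsub hr h0]

lemma kpEval_KPmove {n : ℕ} {α : KPf} {r r' : Root} (hr : r ∈ kbox n) (hr' : r' ∈ kbox n)
    (h0 : α r ≠ 0) (k : ℕ) :
    kpEval n (KPmove α r r') k = kpEval n α k - rootVec r k + rootVec r' k := by
  rw [KPmove, kpEval_KPadd _ hr', kpEval_KPsub hr h0]

lemma redStep_subset (s : List Entry) (e : Entry) : redStep s e ⊆ s ++ [e] := by
  unfold redStep
  split
  · exact List.Subset.trans (List.dropLast_subset s) (List.subset_append_left _ _)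
  · exact List.Subset.refl _

lemma foldl_redStep_subset (w s : List Entry) : w.foldl redStep s ⊆ s ++ w := by
  induction w generalizing s with
  | nil => simp
  | cons e w ih =>
    intro x hx
    have h₁ := ih _ hx
    have h₂ := @redStep_subset s e x
    simp only [List.mem_append, List.mem_cons, List.not_mem_nil, or_false] at *
    tauto

lemma reduceW_subset (w : List Entry) : reduceW w ⊆ w := foldl_redStep_subset w []

lemma mem_of_lastPlus {w : List Entry} {r : Root} (h : lastPlus w = some r) :
    ((true, r) : Entry) ∈ w := by
  obtain ⟨⟨b, q⟩, he, rfl⟩ := Option.map_eq_some_iff.1 h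
  obtain ⟨hm, hb⟩ := List.mem_filter.1 (List.mem_of_getLast? he)
  obtain rfl : b = true := hb
  exact reduceW_subset w hm

lemma mem_of_headMinus {w : List Entry} {r : Root} (h : headMinus w = some r) :
    ((false, r) : Entry) ∈ w := by
  obtain ⟨⟨b, q⟩, he, rfl⟩ := Option.map_eq_some_iff.1 h
  obtain ⟨hm, hb⟩ := List.mem_filter.1 (List.mem_of_head? he)
  obtain rfl : b = false := by simpa using hb
  exact reduceW_subset w hm

lemma exists_lastPlus {w : List Entry} (h : 0 < plusCt (reduceW w)) :
    ∃ r, lastPlus w = some r := by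
  have hne := List.ne_nil_of_length_pos h
  exact ⟨_, by rw [lastPlus, List.getLast?_eq_getLast_of_ne_nil hne, Option.map_some]⟩

lemma of_mem_Wword {n i : ℕ} {α : KPf} {b : Bool} {r : Root}
    (h : ((b, r) : Entry) ∈ Wword n i α) : α r ≠ 0 ∧ r.2 = if b then i else i + 1 := by
  obtain ⟨a, -, ha⟩ := List.mem_flatMap.1 h
  rcases List.mem_append.1 ha with ha | ha <;>
  · obtain ⟨h0, he⟩ := List.mem_replicate.1 ha
    obtain ⟨rfl, rfl⟩ := Prod.mk.inj he
    exact ⟨h0, by simp⟩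

lemma of_mem_Wstar {n i : ℕ} {α : KPf} {b : Bool} {r : Root}
    (h : ((b, r) : Entry) ∈ Wstar n i α) : α r ≠ 0 ∧ r.1 = if b then i + 1 else i := by
  obtain ⟨a, -, ha⟩ := List.mem_flatMap.1 h
  rcases List.mem_append.1 ha with ha | ha <;>
  · obtain ⟨h0, he⟩ := List.mem_replicate.1 ha
    obtain ⟨rfl, rfl⟩ := Prod.mk.inj he
    exact ⟨h0, by simp⟩

/-- `f̃_i` preserves size and adds `α_i` when a plus sign survives in `W_i`. -/
lemma ftilde_spec {n i : ℕ} {α β : KPf} (hi : i + 1 ≤ n) (hα : IsKP n α)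
    (ha : 0 < aSt n i α) (h : ftilde n i α = some β) :
    kpSize n β = kpSize n α ∧ ∀ k, kpEval n β k = kpEval n α k + srVec i k := by
  obtain ⟨⟨a, b⟩, hr⟩ := exists_lastPlus ha
  obtain ⟨h0, hb⟩ := of_mem_Wword (mem_of_lastPlus hr)
  simp only [if_true] at hb
  subst hb
  simp only [ftilde, hr, Option.some.injEq] at h
  subst h
  have hm := hα.mem_kbox h0
  have hm' : ((a, b + 1) : Root) ∈ kbox n := mem_kbox.2 ⟨(mem_kbox.1 hm).1, hi⟩
  refine ⟨kpSize_KPmove hm hm' h0, fun k => ?_⟩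
  rw [kpEval_KPmove hm hm' h0]
  simp only [rootVec, srVec, eq_comm (a := k)]
  ring

/-- `f̃_i*` preserves size and adds `α_i` when a plus sign survives in `W_i*`. -/
lemma ftildeS_spec {n i : ℕ} {α β : KPf} (hi : i + 1 ≤ n) (hα : IsKP n α)
    (ha : 0 < aStar n i α) (h : ftildeS n i α = some β) :
    kpSize n β = kpSize n α ∧ ∀ k, kpEval n β k = kpEval n α k + srVec i k := by
  obtain ⟨⟨a, b⟩, hr⟩ := exists_lastPlus ha
  obtain ⟨h0, hb⟩ := of_mem_Wstar (mem_of_lastPlus hr)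
  simp only [if_true] at hb
  subst hb
  simp only [ftildeS, hr, Option.some.injEq] at h
  subst h
  have hm := hα.mem_kbox h0
  have hm' : ((i, b) : Root) ∈ kbox n := mem_kbox.2 ⟨by omega, (mem_kbox.1 hm).2⟩
  refine ⟨kpSize_KPmove hm hm' h0, fun k => ?_⟩
  rw [kpEval_KPmove hm hm' h0]
  simp only [rootVec, srVec, eq_comm (a := k)]
  ring

/-- Removing a copy of the simple root. -/
lemma KPsub_simple_spec {n i : ℕ} {α : KPf} (hα : IsKP n α) (h0 : α (i, i + 1) ≠ 0) :
    kpSize n (KPsub α (i, i + 1)) + 1 = kpSize n α ∧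
      ∀ k, kpEval n (KPsub α (i, i + 1)) k = kpEval n α k - srVec i k := by
  have hm := hα.mem_kbox h0
  refine ⟨kpSize_KPsub hm h0, fun k => ?_⟩
  rw [kpEval_KPsub hm h0]
  simp only [rootVec, srVec, eq_comm (a := k)]

/-- `ẽ_i` subtracts `α_i`; it preserves size unless it removes a simple root. -/
lemma etilde_spec {n i : ℕ} {α β : KPf} (hi : i + 1 ≤ n) (hα : IsKP n α)
    (h : etilde n i α = some β) :
    (∀ k, kpEval n β k = kpEval n α k - srVec i k) ∧
      ((headMinus (Wword n i α) ≠ some (i, i + 1) ∧ kpSize n β = kpSize n α) ∨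
        (headMinus (Wword n i α) = some (i, i + 1) ∧ α (i, i + 1) ≠ 0 ∧
          β = KPsub α (i, i + 1) ∧ kpSize n β + 1 = kpSize n α)) := by
  rcases hr : headMinus (Wword n i α) with _ | ⟨a, b⟩
  · simp [etilde, hr] at h
  obtain ⟨h0, hb⟩ := of_mem_Wword (mem_of_headMinus hr)
  simp only [Bool.false_eq_true, if_false] at hb
  subst hb
  by_cases hs : ((a, i + 1) : Root) = (i, i + 1)
  · obtain rfl : a = i := (Prod.mk.inj hs).1
    simp only [etilde, hr, if_true, Option.some.injEq] at h
    subst h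
    obtain ⟨h₁, h₂⟩ := KPsub_simple_spec hα h0
    exact ⟨h₂, Or.inr ⟨rfl, h0, rfl, h₁⟩⟩
  · simp only [etilde, hr, hs, if_false, Option.some.injEq] at h
    subst h
    have hm := hα.mem_kbox h0
    have hm' : ((a, i) : Root) ∈ kbox n := mem_kbox.2 ⟨(mem_kbox.1 hm).1, by omega⟩
    refine ⟨fun k => ?_, Or.inl ⟨fun h => hs (Option.some.inj h), kpSize_KPmove hm hm' h0⟩⟩
    rw [kpEval_KPmove hm hm' h0]
    simp only [rootVec, srVec, eq_comm (a := k)]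
    ring

/-- `ẽ_i*` subtracts `α_i`; it preserves size unless it removes a simple root. -/
lemma etildeS_spec {n i : ℕ} {α β : KPf} (hi : i + 1 ≤ n) (hα : IsKP n α)
    (h : etildeS n i α = some β) :
    (∀ k, kpEval n β k = kpEval n α k - srVec i k) ∧
      ((headMinus (Wstar n i α) ≠ some (i, i + 1) ∧ kpSize n β = kpSize n α) ∨
        (headMinus (Wstar n i α) = some (i, i + 1) ∧ α (i, i + 1) ≠ 0 ∧
          β = KPsub α (i, i + 1) ∧ kpSize n β + 1 = kpSize n α)) := by
  rcases hr : headMinus (Wstar n i α) with _ | ⟨a, b⟩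
  · simp [etildeS, hr] at h
  obtain ⟨h0, hb⟩ := of_mem_Wstar (mem_of_headMinus hr)
  simp only [Bool.false_eq_true, if_false] at hb
  subst hb
  by_cases hs : ((a, b) : Root) = (a, a + 1)
  · obtain rfl : b = a + 1 := (Prod.mk.inj hs).2
    simp only [etildeS, hr, if_true, Option.some.injEq] at h
    subst h
    obtain ⟨h₁, h₂⟩ := KPsub_simple_spec hα h0
    exact ⟨h₂, Or.inr ⟨rfl, h0, rfl, h₁⟩⟩
  · simp only [etildeS, hr, hs, if_false, Option.some.injEq] at h
    subst h
    have hm := hα.mem_kbox h0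
    have hm' : ((a + 1, b) : Root) ∈ kbox n := mem_kbox.2 ⟨hi, (mem_kbox.1 hm).2⟩
    refine ⟨fun k => ?_, Or.inl ⟨fun h => hs (Option.some.inj h), kpSize_KPmove hm hm' h0⟩⟩
    rw [kpEval_KPmove hm hm' h0]
    simp only [rootVec, srVec, eq_comm (a := k)]
    ring

lemma fop_spec {n i : ℕ} {α β : KPf} (hi : i + 1 ≤ n) (hα : IsKP n α)
    (h : fop n i α = some β) :
    kpSize n β = kpSize n α ∧ ∀ k, kpEval n β k = kpEval n α k + srVec i k := by
  unfold fop at h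
  split_ifs at h with h₁ h₂
  · exact ftilde_spec hi hα (by omega) h
  · exact ftildeS_spec hi hα h₂ h

lemma ehat_spec {n i : ℕ} {α β : KPf} (hi : i + 1 ≤ n) (hα : IsKP n α)
    (h : ehat n i α = some β) :
    (∀ k, kpEval n β k = kpEval n α k - srVec i k) ∧
      ((eop n i α = some β ∧ kpSize n β = kpSize n α) ∨
        (eop n i α = none ∧ α (i, i + 1) ≠ 0 ∧ β = KPsub α (i, i + 1) ∧
          kpSize n β + 1 = kpSize n α)) := by
  unfold ehat at h
  split_ifs at h with h₁ h₂
  · obtain ⟨he, ⟨hm, hs⟩ | ⟨hm, hs⟩⟩ := etilde_spec hi hα h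
    · exact ⟨he, Or.inl ⟨by rw [eop, if_pos h₁, if_pos ⟨h₂, hm⟩, h], hs⟩⟩
    · exact ⟨he, Or.inr ⟨by rw [eop, if_pos h₁, if_neg fun h => h.2 hm], hs⟩⟩
  · obtain ⟨he, ⟨hm, hs⟩ | ⟨hm, hs⟩⟩ := etildeS_spec hi hα h
    · exact ⟨he, Or.inl ⟨by rw [eop, if_neg h₁, if_pos hm, h], hs⟩⟩
    · exact ⟨he, Or.inr ⟨by rw [eop, if_neg h₁, if_neg fun h => h hm], hs⟩⟩

lemma ehat_eq_of_eop_eq {n i : ℕ} {α β : KPf} (h : eop n i α = some β) :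
    ehat n i α = some β := by
  unfold eop at h
  split_ifs at h with h₁ h₂ h₃
  · rw [ehat, if_pos h₁, if_pos h₂.1, h]
  · rw [ehat, if_neg h₁, h]

end KFC

open KFC in
/-- The modified operators preserve size and shift the evaluation by the simple
root `α_i`; `e_i` agrees with `ê_i` whenever it is nonzero, and `ê_i` can
additionally remove one copy of the simple root `(i,i+1)` when `e_i` is zero. -/
theorem stmt19 (n : ℕ) (hn : 2 ≤ n) (i : ℕ) (hi1 : 1 ≤ i) (hi2 : i ≤ n - 1)
    (α : KPf) (hα : IsKP n α) :
    (∀ β, fop n i α = some β → kpSize n β = kpSize n α ∧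
      ∀ k, kpEval n β k = kpEval n α k + srVec i k) ∧
    (∀ β, eop n i α = some β → ehat n i α = some β ∧ kpSize n β = kpSize n α ∧
      ∀ k, kpEval n β k = kpEval n α k - srVec i k) ∧
    (∀ β, ehat n i α = some β → (∀ k, kpEval n β k = kpEval n α k - srVec i k) ∧
      ((eop n i α = some β ∧ kpSize n β = kpSize n α) ∨
       (eop n i α = none ∧ α (i, i+1) ≠ 0 ∧ β = KPsub α (i, i+1) ∧
         kpSize n β + 1 = kpSize n α))) := by
  have hi : i + 1 ≤ n := by omega
  refine ⟨fun β h => fop_spec hi hα h, fun β h => ?_, fun β h => ehat_spec hi hα h⟩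
  have hh := ehat_eq_of_eop_eq h
  obtain ⟨he, ⟨-, hs⟩ | ⟨hn, -⟩⟩ := ehat_spec hi hα hh
  · exact ⟨hh, hs, he⟩
  · simp [hn] at h
end
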